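/- arXiv:1501.07215 — 2 statements merged into one kernel-verified Lean document; each statement's English description precedes it below -/
import Mathlib

section
/- Let T be a set functor and L a one-step language closed under disjunction (for all φ,ψ ∈ L(A) there is χ ∈ L(A) with χ_X(V) = φ_X(V) ∪ ψ_X(V)). Then the class of non-deterministic L-automata is closed under existential projection over T-tree models: for every non-deterministic P-chromatic L-automaton 𝔸 and every q ∈ P there is a non-deterministic (P∖{q})-chromatic L-automaton ∃q.𝔸 such that for every T-tree model (S,R,σ,V,u) with V a (P∖{q})-valuation: ∃q.𝔸 accepts (S,R,σ,V,u) if and only if there is Z ⊆ S such that 𝔸 accepts (S,R,σ,V[q↦Z],u). -/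
open scoped Classical

/-- A set functor: an endofunctor on the category of sets (types in `Type`). -/
structure SetFunctor where
  obj : Type → Type
  map : {X Y : Type} → (X → Y) → obj X → obj Y
  map_id : ∀ {X : Type} (x : obj X), map id x = x
  map_comp : ∀ {X Y Z : Type} (f : X → Y) (g : Y → Z) (x : obj X),
    map (g ∘ f) x = map g (map f x)

/-- A generalized predicate lifting over a set `A` of variables. -/
structure GenLifting (T : SetFunctor) (A : Type) where
  app : (X : Type) → (A → Set X) → Set (T.obj X)

/-- A generalized predicate lifting is monotone if it is monotone in each variable. -/
def GenLifting.Mono {T : SetFunctor} {A : Type} (φ : GenLifting T A) : Prop :=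
  ∀ (X : Type) (V V' : A → Set X), (∀ a : A, V a ⊆ V' a) → φ.app X V ⊆ φ.app X V'

/-- A one-step language: a collection of generalized predicate liftings
for each set of variables. -/
def OneStepLang (T : SetFunctor) : Type 1 :=
  (A : Type) → Set (GenLifting T A)

/-- `RPath R s t l`: `l` is the list of successive nodes (after `s`) of an `R`-path
from `s` to `t`. -/
inductive RPath {S : Type} (R : S → S → Prop) : S → S → List S → Prop
  | nil (s : S) : RPath R s s []
  | cons {s t w : S} {l : List S} : R s t → RPath R t w l → RPath R s w (t :: l)

/-- A `T`-tree model: a `T`-model together with a supporting Kripke frame `R`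
(witnessed by the local coalgebra structure `σloc`) such that `(S,R)` is a tree
rooted at `root` (there is a unique `R`-path from the root to every node). -/
structure TreeModel (T : SetFunctor) where
  S : Type
  σ : S → T.obj S
  V : ℕ → Set S
  R : S → S → Prop
  root : S
  σloc : (s : S) → T.obj {t : S // R s t}
  σloc_spec : ∀ s : S, T.map (Subtype.val) (σloc s) = σ s
  tree : ∀ w : S, ∃! l : List S, RPath R root w l

/-- A `P`-chromatic `L`-automaton. -/
structure Automaton (T : SetFunctor) (L : OneStepLang T) where
  P : Set ℕ
  Pfin : P.Finite
  St : Type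
  fin : Finite St
  aI : St
  Ω : St → ℕ
  Δ : St → Set ℕ → GenLifting T St
  Δ_mem : ∀ (a : St) (c : Set ℕ), Δ a c ∈ L St

/-- The colour of a state: the set of proposition letters from `P` true at it. -/
def Automaton.color {T : SetFunctor} {L : OneStepLang T} (aut : Automaton T L)
    (M : TreeModel T) (s : M.S) : Set ℕ :=
  {p | p ∈ aut.P ∧ s ∈ M.V p}

/-- A move `U` of ∃ at a basic position `(a,s)` is legal if it assigns to each
automaton state a set of `R`-successors of `s`, in such a way that the resulting
one-step model over `R(s)` satisfies the one-step formula `Δ(a, V†(s))`. -/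
def Automaton.Legal {T : SetFunctor} {L : OneStepLang T} (aut : Automaton T L)
    (M : TreeModel T) (a : aut.St) (s : M.S) (U : aut.St → Set M.S) : Prop :=
  (∀ b : aut.St, U b ⊆ {t : M.S | M.R s t}) ∧
  M.σloc s ∈ (aut.Δ a (aut.color M s)).app {t : M.S // M.R s t}
      (fun b => {t : {t' : M.S // M.R s t'} | t.1 ∈ U b})

/-- The histories (lists of basic positions, most recent first) of the acceptance
game that can be reached when ∃ plays according to the strategy `st`. -/
inductive Reach {T : SetFunctor} {L : OneStepLang T} (aut : Automaton T L) (M : TreeModel T)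
    (st : List (aut.St × M.S) → aut.St → Set M.S) : List (aut.St × M.S) → Prop
  | base : Reach aut M st [(aut.aI, M.root)]
  | step {h : List (aut.St × M.S)} {p q : aut.St × M.S} :
      Reach aut M st (p :: h) → q.2 ∈ st (p :: h) q.1 → Reach aut M st (q :: p :: h)

/-- The history (most recent first) consisting of the first `n+1` positions of a play. -/
def histPrefix {α : Type} (f : ℕ → α) (n : ℕ) : List α :=
  ((List.range (n + 1)).map f).reverse

/-- ∃ wins an infinite match iff the maximal parity occurring infinitely often is even. -/
def Automaton.WinsParity {T : SetFunctor} {L : OneStepLang T} (aut : Automaton T L)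
    (M : TreeModel T) (f : ℕ → aut.St × M.S) : Prop :=
  ∃ n : ℕ, Even n ∧ (∃ᶠ i in Filter.atTop, aut.Ω (f i).1 = n) ∧
    ∀ m : ℕ, (∃ᶠ i in Filter.atTop, aut.Ω (f i).1 = m) → m ≤ n

/-- Acceptance: ∃ has a strategy that is legal along all reachable histories
(so ∃ never gets stuck) and wins all infinite matches played according to it. -/
def Automaton.Accepts {T : SetFunctor} {L : OneStepLang T} (aut : Automaton T L)
    (M : TreeModel T) : Prop :=
  ∃ st : List (aut.St × M.S) → aut.St → Set M.S,
    (∀ (h : List (aut.St × M.S)) (a : aut.St) (s : M.S),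
        Reach aut M st ((a, s) :: h) → aut.Legal M a s (st ((a, s) :: h))) ∧
    (∀ f : ℕ → aut.St × M.S, f 0 = (aut.aI, M.root) →
        (∀ n : ℕ, (f (n + 1)).2 ∈ st (histPrefix f n) (f (n + 1)).1) →
        aut.WinsParity M f)

/-- A generalized predicate lifting is special basic if every satisfying valuation can
be shrunk to a satisfying valuation assigning pairwise disjoint sets to the variables. -/
def GenLifting.SpecialBasic {T : SetFunctor} {A : Type} (φ : GenLifting T A) : Prop :=
  ∀ (X : Type) (α : T.obj X) (V : A → Set X), α ∈ φ.app X V →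
    ∃ V' : A → Set X, (∀ a : A, V' a ⊆ V a) ∧
      (∀ a b : A, a ≠ b → V' a ∩ V' b = ∅) ∧ α ∈ φ.app X V'

/-- An automaton is non-deterministic if all its one-step formulas are special basic. -/
def Automaton.NonDet {T : SetFunctor} {L : OneStepLang T} (aut : Automaton T L) : Prop :=
  ∀ (a : aut.St) (c : Set ℕ), (aut.Δ a c).SpecialBasic

/-- The valuation `V[q ↦ Z]`. -/
noncomputable def updV {X : Type} (V : ℕ → Set X) (q : ℕ) (Z : Set X) : ℕ → Set X :=
  fun p => if p = q then Z else V p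

theorem RPath.snoc {S : Type} {R : S → S → Prop} {s t w : S} {l : List S}
    (h : RPath R s t l) (hw : R t w) : RPath R s w (l ++ [w]) := by
  induction h with
  | nil s => exact .cons hw (.nil w)
  | cons hst _ ih => exact .cons hst (ih hw)

section Automata

variable {T : SetFunctor} {L : OneStepLang T}

/-- Shrinking a legal move of a non-deterministic automaton to one with disjoint components. -/
theorem Automaton.Legal.exists_disjoint {aut : Automaton T L} (haut : aut.NonDet)
    {M : TreeModel T} {a : aut.St} {s : M.S} {U : aut.St → Set M.S} (hU : aut.Legal M a s U) :
    ∃ U' : aut.St → Set M.S, (∀ b, U' b ⊆ U b) ∧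
      (∀ b c, b ≠ c → U' b ∩ U' c = ∅) ∧ aut.Legal M a s U' := by
  obtain ⟨V', hsub, hdis, hV'⟩ := haut a (aut.color M s) _ _ _ hU.2
  refine ⟨fun b => Subtype.val '' V' b, ?_, ?_, ?_, ?_⟩
  · rintro b _ ⟨t, ht, rfl⟩
    exact hsub b ht
  · intro b c hbc
    rw [← Set.image_inter Subtype.val_injective, hdis b c hbc, Set.image_empty]
  · rintro b _ ⟨t, _, rfl⟩
    exact t.2
  · convert hV' using 2
    exact funext fun b => Set.preimage_image_eq (V' b) Subtype.val_injective

theorem Reach.mono {aut : Automaton T L} {M : TreeModel T}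
    {st st' : List (aut.St × M.S) → aut.St → Set M.S} (hsub : ∀ h b, st' h b ⊆ st h b)
    {h : List (aut.St × M.S)} (hr : Reach aut M st' h) : Reach aut M st h := by
  induction hr with
  | base => exact .base
  | step _ hmem ih => exact .step ih (hsub _ _ hmem)

/-- A non-deterministic automaton that accepts a tree model does so by means of a strategy
all of whose moves have pairwise disjoint components. -/
theorem Automaton.Accepts.exists_disjoint {aut : Automaton T L} (haut : aut.NonDet)
    {M : TreeModel T} (hacc : aut.Accepts M) :
    ∃ st : List (aut.St × M.S) → aut.St → Set M.S,
      (∀ h a s, Reach aut M st ((a, s) :: h) → aut.Legal M a s (st ((a, s) :: h))) ∧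
      (∀ h, Reach aut M st h → ∀ b c, b ≠ c → st h b ∩ st h c = ∅) ∧
      (∀ f : ℕ → aut.St × M.S, f 0 = (aut.aI, M.root) →
        (∀ n : ℕ, (f (n + 1)).2 ∈ st (histPrefix f n) (f (n + 1)).1) →
        aut.WinsParity M f) := by
  obtain ⟨st, hleg, hwin⟩ := hacc
  have key : ∀ h : List (aut.St × M.S), ∃ U : aut.St → Set M.S, (∀ b, U b ⊆ st h b) ∧
      (∀ b c, b ≠ c → U b ∩ U c = ∅) ∧
      ∀ a s l, h = (a, s) :: l → Reach aut M st h → aut.Legal M a s U := by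
    intro h
    by_cases hh : ∃ a s l, h = (a, s) :: l ∧ Reach aut M st h
    · obtain ⟨a, s, l, rfl, hr⟩ := hh
      obtain ⟨U, hsub, hdis, hU⟩ := (hleg l a s hr).exists_disjoint haut
      refine ⟨U, hsub, hdis, ?_⟩
      intro a' s' l' heq _
      cases heq
      exact hU
    · exact ⟨fun _ => ∅, fun _ => Set.empty_subset _, fun _ _ _ => Set.empty_inter _,
        fun a s l heq hr => (hh ⟨a, s, l, heq, hr⟩).elim⟩
  choose st' hsub hdis hleg' using key
  exact ⟨st', fun h a s hr => hleg' _ a s h rfl (hr.mono hsub), fun h _ => hdis h,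
    fun f h0 hf => hwin f h0 fun n => hsub _ _ (hf n)⟩

/-- The nodes of a reachable history form a path from the root. -/
theorem Reach.exists_rPath {aut : Automaton T L} {M : TreeModel T}
    {st : List (aut.St × M.S) → aut.St → Set M.S}
    (hleg : ∀ h a s, Reach aut M st ((a, s) :: h) → aut.Legal M a s (st ((a, s) :: h)))
    {h : List (aut.St × M.S)} (hr : Reach aut M st h) :
    ∃ p h', h = p :: h' ∧ ∃ l, RPath M.R M.root p.2 l ∧
      h.map Prod.snd = (M.root :: l).reverse := by
  induction hr with
  | base => exact ⟨_, _, rfl, [], .nil _, rfl⟩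
  | @step h p r hp hmem ih =>
    obtain ⟨p', h', heq, l, hl, hmap⟩ := ih
    cases heq
    refine ⟨_, _, rfl, l ++ [r.2], hl.snoc ((hleg h p.1 p.2 hp).1 _ hmem), ?_⟩
    rw [List.map_cons, hmap]
    simp

theorem Reach.eq_of_map_snd_eq {aut : Automaton T L} {M : TreeModel T}
    {st : List (aut.St × M.S) → aut.St → Set M.S}
    (hdis : ∀ h, Reach aut M st h → ∀ b c, b ≠ c → st h b ∩ st h c = ∅)
    {h₁ h₂ : List (aut.St × M.S)} (hr₁ : Reach aut M st h₁) (hr₂ : Reach aut M st h₂)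
    (hmap : h₁.map Prod.snd = h₂.map Prod.snd) : h₁ = h₂ := by
  induction hr₁ generalizing h₂ with
  | base =>
    cases hr₂ with
    | base => rfl
    | step _ _ => simp at hmap
  | @step l p r hp hmem ih =>
    cases hr₂ with
    | base => simp at hmap
    | @step l' p' r' hp' hmem' =>
      replace hmap := List.cons.inj hmap
      have htail := ih hp' hmap.2
      rw [← htail] at hmem' ⊢
      have hfst : r.1 = r'.1 := by
        by_contra hne
        have hmem_inter : r.2 ∈ st (p :: l) r.1 ∩ st (p :: l) r'.1 :=
          ⟨hmem, hmap.1 ▸ hmem'⟩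
        rw [hdis _ hp _ _ hne] at hmem_inter
        exact hmem_inter
      rw [Prod.ext hfst hmap.1]

/-- Under a strategy with disjoint moves, every node is reached by at most one history. -/
theorem Reach.eq_of_node_eq {aut : Automaton T L} {M : TreeModel T}
    {st : List (aut.St × M.S) → aut.St → Set M.S}
    (hleg : ∀ h a s, Reach aut M st ((a, s) :: h) → aut.Legal M a s (st ((a, s) :: h)))
    (hdis : ∀ h, Reach aut M st h → ∀ b c, b ≠ c → st h b ∩ st h c = ∅)
    {a b : aut.St} {s : M.S} {h₁ h₂ : List (aut.St × M.S)}
    (hr₁ : Reach aut M st ((a, s) :: h₁)) (hr₂ : Reach aut M st ((b, s) :: h₂)) :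
    (a, s) :: h₁ = (b, s) :: h₂ := by
  refine hr₁.eq_of_map_snd_eq hdis hr₂ ?_
  obtain ⟨_, _, heq₁, l₁, hl₁, hmap₁⟩ := hr₁.exists_rPath hleg
  obtain ⟨_, _, heq₂, l₂, hl₂, hmap₂⟩ := hr₂.exists_rPath hleg
  cases heq₁
  cases heq₂
  rw [hmap₁, hmap₂, (M.tree s).unique hl₁ hl₂]

/-- The automaton `aut` with the letter `q` removed and transition map replaced by `D`. -/
@[reducible] def Automaton.project (aut : Automaton T L) (q : ℕ)
    (D : aut.St → Set ℕ → GenLifting T aut.St) (hD : ∀ a c, D a c ∈ L aut.St) :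
    Automaton T L where
  P := aut.P \ {q}
  Pfin := aut.Pfin.subset Set.sdiff_subset
  St := aut.St
  fin := aut.fin
  aI := aut.aI
  Ω := aut.Ω
  Δ := D
  Δ_mem := hD

/-- The model `M` with the valuation of `q` replaced by `Z`. -/
@[reducible] noncomputable def TreeModel.update (M : TreeModel T) (q : ℕ) (Z : Set M.S) :
    TreeModel T :=
  { M with V := updV M.V q Z }

variable {aut : Automaton T L} {q : ℕ} {D : aut.St → Set ℕ → GenLifting T aut.St}
  {hD : ∀ a c, D a c ∈ L aut.St} {M : TreeModel T} {Z : Set M.S}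

theorem Automaton.color_update_of_mem (hq : q ∈ aut.P) {s : M.S} (hs : s ∈ Z) :
    aut.color (M.update q Z) s = insert q ((aut.project q D hD).color M s) := by
  ext p
  by_cases hp : p = q
  · subst hp
    simp [Automaton.color, updV, hq, hs]
  · simp [Automaton.color, updV, hp]

theorem Automaton.color_update_of_notMem {s : M.S} (hs : s ∉ Z) :
    aut.color (M.update q Z) s = (aut.project q D hD).color M s := by
  ext p
  by_cases hp : p = q
  · subst hp
    simp [Automaton.color, updV, hs]
  · simp [Automaton.color, updV, hp]

theorem reach_update_iff {st : List (aut.St × M.S) → aut.St → Set M.S}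
    {h : List (aut.St × M.S)} :
    Reach aut (M.update q Z) st h ↔ Reach (aut.project q D hD) M st h := by
  constructor
  · exact Reach.rec (aut := aut) (M := M.update q Z) (st := st)
      (motive := fun h _ => Reach (aut.project q D hD) M st h)
      .base fun _ hmem ih => .step ih hmem
  · exact Reach.rec (aut := aut.project q D hD) (M := M) (st := st)
      (motive := fun h _ => Reach aut (M.update q Z) st h)
      .base fun _ hmem ih => .step ih hmem

theorem Automaton.NonDet.project (haut : aut.NonDet)
    (happ : ∀ a c X V,
      (D a c).app X V = (aut.Δ a c).app X V ∪ (aut.Δ a (insert q c)).app X V) :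
    (aut.project q D hD).NonDet := by
  intro a c X α V hα
  rw [show (aut.project q D hD).Δ a c = D a c from rfl] at hα ⊢
  rw [happ] at hα
  rcases hα with hα | hα
  · obtain ⟨V', hsub, hdis, hV'⟩ := haut _ _ _ _ _ hα
    exact ⟨V', hsub, hdis, by rw [happ]; exact .inl hV'⟩
  · obtain ⟨V', hsub, hdis, hV'⟩ := haut _ _ _ _ _ hα
    exact ⟨V', hsub, hdis, by rw [happ]; exact .inr hV'⟩

theorem Automaton.Accepts.project (hq : q ∈ aut.P)
    (happ : ∀ a c X V,
      (D a c).app X V = (aut.Δ a c).app X V ∪ (aut.Δ a (insert q c)).app X V)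
    (hacc : aut.Accepts (M.update q Z)) : (aut.project q D hD).Accepts M := by
  obtain ⟨st, hleg, hwin⟩ := hacc
  refine ⟨st, fun h a s hr => ?_, hwin⟩
  obtain ⟨hsucc, hsat⟩ := hleg h a s (reach_update_iff.2 hr)
  refine ⟨hsucc, ?_⟩
  change _ ∈ (D a _).app _ _
  rw [happ]
  by_cases hs : s ∈ Z
  · rw [Automaton.color_update_of_mem (D := D) (hD := hD) hq hs] at hsat
    exact .inr hsat
  · rw [Automaton.color_update_of_notMem (D := D) (hD := hD) hs] at hsat
    exact .inl hsat

theorem Automaton.Accepts.exists_update (haut : aut.NonDet) (hq : q ∈ aut.P)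
    (happ : ∀ a c X V,
      (D a c).app X V = (aut.Δ a c).app X V ∪ (aut.Δ a (insert q c)).app X V)
    (hacc : (aut.project q D hD).Accepts M) : ∃ Z : Set M.S, aut.Accepts (M.update q Z) := by
  obtain ⟨st, hleg, hdis, hwin⟩ := hacc.exists_disjoint (haut.project happ)
  let Z : Set M.S := {s | ∃ h a, Reach (aut.project q D hD) M st ((a, s) :: h) ∧
    M.σloc s ∈ (aut.Δ a (insert q ((aut.project q D hD).color M s))).app {t : M.S // M.R s t}
      (fun b => {t | t.1 ∈ st ((a, s) :: h) b})}
  refine ⟨Z, st, fun h a s hr => ?_, hwin⟩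
  replace hr : Reach (aut.project q D hD) M st ((a, s) :: h) := reach_update_iff.1 hr
  obtain ⟨hsucc, hsat⟩ := hleg h a s hr
  refine ⟨hsucc, ?_⟩
  by_cases hs : s ∈ Z
  · rw [Automaton.color_update_of_mem (D := D) (hD := hD) hq hs]
    obtain ⟨h', a', hr', hsat'⟩ := hs
    cases Reach.eq_of_node_eq hleg hdis hr hr'
    exact hsat'
  · rw [Automaton.color_update_of_notMem (D := D) (hD := hD) hs]
    change _ ∈ (D a _).app _ _ at hsat
    rw [happ] at hsat
    exact hsat.resolve_right fun hsat' => hs ⟨h, a, hr, hsat'⟩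

end Automata

/-- If the one-step language `L` is closed under disjunction, then the
class of non-deterministic `L`-automata is closed under existential projection over
`T`-tree models. -/
theorem nondet_automata_closed_under_projection (T : SetFunctor) (L : OneStepLang T)
    (hdisj : ∀ (A : Type), Finite A → ∀ φ ∈ L A, ∀ ψ ∈ L A, ∃ χ ∈ L A,
      ∀ (X : Type) (V : A → Set X), χ.app X V = φ.app X V ∪ ψ.app X V)
    (aut : Automaton T L) (haut : aut.NonDet) (q : ℕ) (hq : q ∈ aut.P) :
    ∃ autq : Automaton T L, autq.P = aut.P \ {q} ∧ autq.NonDet ∧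
      ∀ M : TreeModel T, autq.Accepts M ↔
        ∃ Z : Set M.S, aut.Accepts { M with V := updV M.V q Z } := by
  choose D hD happ using fun (a : aut.St) (c : Set ℕ) =>
    hdisj aut.St aut.fin _ (aut.Δ_mem a c) _ (aut.Δ_mem a (insert q c))
  exact ⟨aut.project q D hD, rfl, haut.project happ, fun M =>
    ⟨fun hacc => hacc.exists_update haut hq happ, fun ⟨_, hacc⟩ => hacc.project hq happ⟩⟩
end

section
/- Let T be a set functor and Λ a set of monotone predicate liftings for T. Over T-tree models, the class Aut(SO_Λ) of second-order Λ-automata is closed under existential projection: for every P-chromatic automaton 𝔸 ∈ Aut(SO_Λ) and every q ∈ P there is a (P∖{q})-chromatic automaton 𝔸′ ∈ Aut(SO_Λ) such that for every T-tree model (S,R,σ,V,u) with V a (P∖{q})-valuation: 𝔸′ accepts (S,R,σ,V,u) if and only if there is Z ⊆ S such that 𝔸 accepts (S,R,σ,V[q↦Z],u). -/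
open scoped Classical

/-- An `n`-place predicate lifting for `T`: a natural transformation `𝒬(-)ⁿ → 𝒬 ∘ T`. -/
structure PredLifting (T : SetFunctor) (n : ℕ) where
  app : (X : Type) → (Fin n → Set X) → Set (T.obj X)
  natural : ∀ {X Y : Type} (f : X → Y) (V : Fin n → Set Y),
    app X (fun i => f ⁻¹' V i) = T.map f ⁻¹' app Y V

/-- Monotonicity of a predicate lifting. -/
def PredLifting.Mono {T : SetFunctor} {n : ℕ} (l : PredLifting T n) : Prop :=
  ∀ (X : Type) (V V' : Fin n → Set X), (∀ i, V i ⊆ V' i) → l.app X V ⊆ l.app X V'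

/-- A set `Λ` of monotone predicate liftings for `T`, presented as an indexed family. -/
structure LiftingFamily (T : SetFunctor) where
  ι : Type
  ar : ι → ℕ
  lf : (i : ι) → PredLifting T (ar i)
  mono : ∀ i, (lf i).Mono

/-- Naturality for generalized predicate liftings. -/
def GenLifting.Natural {T : SetFunctor} {A : Type} (φ : GenLifting T A) : Prop :=
  ∀ (X Y : Type) (f : X → Y) (V : A → Set Y),
    φ.app X (fun a => f ⁻¹' V a) = T.map f ⁻¹' φ.app Y V

/-- Formulas of the one-step second-order language over variables `W`
(relative to the liftings in `F`). -/
inductive SOForm {T : SetFunctor} (F : LiftingFamily T) (W : Type) : Type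
  | subset (a b : W)
  | lift (i : F.ι) (v : Fin (F.ar i) → W)
  | neg (φ : SOForm F W)
  | or (φ ψ : SOForm F W)
  | ex (w : W) (φ : SOForm F W)

/-- Updating a valuation at one variable. -/
noncomputable def updW {W X : Type} (V : W → Set X) (w : W) (Z : Set X) : W → Set X :=
  fun w' => if w' = w then Z else V w'

/-- One-step satisfaction of second-order one-step formulas in a one-step model `(X, α, V)`. -/
def SOForm.sat {T : SetFunctor} {F : LiftingFamily T} {W : Type} (X : Type) (α : T.obj X) :
    SOForm F W → (W → Set X) → Prop
  | .subset a b, V => V a ⊆ V b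
  | .lift i v, V => α ∈ (F.lf i).app X (fun k => V (v k))
  | .neg φ, V => ¬ φ.sat X α V
  | .or φ ψ, V => φ.sat X α V ∨ ψ.sat X α V
  | .ex w φ, V => ∃ Z : Set X, φ.sat X α (updW V w Z)

/-- Free variables of a one-step second-order formula. -/
def SOForm.fv {T : SetFunctor} {F : LiftingFamily T} {W : Type} : SOForm F W → Set W
  | .subset a b => {a, b}
  | .lift _ v => Set.range v
  | .neg φ => φ.fv
  | .or φ ψ => φ.fv ∪ ψ.fv
  | .ex w φ => φ.fv \ {w}

/-- Quantifier depth of a one-step second-order formula. -/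
def SOForm.qd {T : SetFunctor} {F : LiftingFamily T} {W : Type} : SOForm F W → ℕ
  | .subset _ _ => 0
  | .lift _ _ => 0
  | .neg φ => φ.qd
  | .or φ ψ => max φ.qd ψ.qd
  | .ex _ φ => φ.qd + 1

/-- A one-step second-order sentence over `A`: a formula over `A ⊕ ℕ` all of whose
free variables come from `A`. -/
def IsSentence {T : SetFunctor} {F : LiftingFamily T} {A : Type}
    (φ : SOForm F (A ⊕ ℕ)) : Prop :=
  ∀ w ∈ φ.fv, ∃ a : A, w = Sum.inl a

/-- Satisfaction of a sentence over `A` at a one-step model `(X, α, V)` with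
`V : A → Set X` (bound variables are initialized arbitrarily). -/
def SOForm.sat0 {T : SetFunctor} {F : LiftingFamily T} {A : Type} (X : Type) (α : T.obj X)
    (φ : SOForm F (A ⊕ ℕ)) (V : A → Set X) : Prop :=
  φ.sat X α (Sum.elim V (fun _ => (∅ : Set X)))

/-- The generalized predicate lifting induced by a one-step second-order sentence. -/
def SOForm.toLifting {T : SetFunctor} {F : LiftingFamily T} {A : Type}
    (φ : SOForm F (A ⊕ ℕ)) : GenLifting T A :=
  ⟨fun X V => {α : T.obj X | φ.sat0 X α V}⟩

/-- A `P`-chromatic second-order `Λ`-automaton. -/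
structure SOAutomaton (T : SetFunctor) (F : LiftingFamily T) where
  P : Set ℕ
  Pfin : P.Finite
  St : Type
  fin : Finite St
  aI : St
  Ω : St → ℕ
  Δ : St → Set ℕ → SOForm F (St ⊕ ℕ)
  sentence : ∀ (a : St) (c : Set ℕ), IsSentence (Δ a c)

/-- The colour of a state of a tree model. -/
def SOAutomaton.color {T : SetFunctor} {F : LiftingFamily T} (aut : SOAutomaton T F)
    (M : TreeModel T) (s : M.S) : Set ℕ :=
  {p | p ∈ aut.P ∧ s ∈ M.V p}

/-- Legality of ∃'s moves in the acceptance game. -/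
def SOAutomaton.Legal {T : SetFunctor} {F : LiftingFamily T} (aut : SOAutomaton T F)
    (M : TreeModel T) (a : aut.St) (s : M.S) (U : aut.St → Set M.S) : Prop :=
  (∀ b : aut.St, U b ⊆ {t : M.S | M.R s t}) ∧
  (aut.Δ a (aut.color M s)).sat0 {t : M.S // M.R s t} (M.σloc s)
    (fun b => {t : {t' : M.S // M.R s t'} | t.1 ∈ U b})

/-- Histories of the acceptance game reachable under strategy `st`. -/
inductive SOReach {T : SetFunctor} {F : LiftingFamily T} (aut : SOAutomaton T F)
    (M : TreeModel T) (st : List (aut.St × M.S) → aut.St → Set M.S) :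
    List (aut.St × M.S) → Prop
  | base : SOReach aut M st [(aut.aI, M.root)]
  | step {h : List (aut.St × M.S)} {p q : aut.St × M.S} :
      SOReach aut M st (p :: h) → q.2 ∈ st (p :: h) q.1 → SOReach aut M st (q :: p :: h)

/-- ∃ wins an infinite match iff the maximal parity occurring infinitely often is even. -/
def SOAutomaton.WinsParity {T : SetFunctor} {F : LiftingFamily T} (aut : SOAutomaton T F)
    (M : TreeModel T) (f : ℕ → aut.St × M.S) : Prop :=
  ∃ n : ℕ, Even n ∧ (∃ᶠ i in Filter.atTop, aut.Ω (f i).1 = n) ∧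
    ∀ m : ℕ, (∃ᶠ i in Filter.atTop, aut.Ω (f i).1 = m) → m ≤ n

/-- Acceptance of a `T`-tree model by a second-order automaton. -/
def SOAutomaton.Accepts {T : SetFunctor} {F : LiftingFamily T} (aut : SOAutomaton T F)
    (M : TreeModel T) : Prop :=
  ∃ st : List (aut.St × M.S) → aut.St → Set M.S,
    (∀ (h : List (aut.St × M.S)) (a : aut.St) (s : M.S),
        SOReach aut M st ((a, s) :: h) → aut.Legal M a s (st ((a, s) :: h))) ∧
    (∀ f : ℕ → aut.St × M.S, f 0 = (aut.aI, M.root) →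
        (∀ n : ℕ, (f (n + 1)).2 ∈ st (histPrefix f n) (f (n + 1)).1) →
        aut.WinsParity M f)

section OneStep

variable {T : SetFunctor} {F : LiftingFamily T}

/-- Renaming of variables. -/
def SOForm.rename {W W' : Type} (f : W → W') : SOForm F W → SOForm F W'
  | .subset a b => .subset (f a) (f b)
  | .lift i v => .lift i (f ∘ v)
  | .neg φ => .neg (φ.rename f)
  | .or φ ψ => .or (φ.rename f) (ψ.rename f)
  | .ex w φ => .ex (f w) (φ.rename f)

theorem SOForm.sat_rename {W W' : Type} {f : W → W'} (hf : Function.Injective f)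
    (φ : SOForm F W) {X : Type} (α : T.obj X) (V : W' → Set X) :
    (φ.rename f).sat X α V ↔ φ.sat X α (V ∘ f) := by
  induction φ generalizing V with
  | subset a b => rfl
  | lift i v => rfl
  | neg φ ih => simp only [rename, sat, ih]
  | or φ ψ ih₁ ih₂ => simp only [rename, sat, ih₁, ih₂]
  | ex w φ ih =>
    have h : ∀ Z, updW V (f w) Z ∘ f = updW (V ∘ f) w Z := by
      intro Z
      funext w'
      simp [updW, hf.eq_iff]
    simp only [rename, sat, ih, h]

theorem SOForm.fv_rename {W W' : Type} (f : W → W') (φ : SOForm F W) :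
    (φ.rename f).fv ⊆ f '' φ.fv := by
  induction φ with
  | subset a b => simp [rename, fv, Set.image_pair]
  | lift i v => simp [rename, fv, Set.range_comp]
  | neg φ ih => exact ih
  | or φ ψ ih₁ ih₂ =>
    simp only [rename, fv, Set.image_union]
    exact Set.union_subset_union ih₁ ih₂
  | ex w φ ih =>
    rintro x ⟨hx, hxw⟩
    obtain ⟨y, hy, rfl⟩ := ih hx
    exact ⟨y, ⟨hy, fun h => hxw (congrArg f h)⟩, rfl⟩

theorem SOForm.sat_congr {W : Type} (φ : SOForm F W) {X : Type} (α : T.obj X)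
    {V V' : W → Set X} (h : ∀ w ∈ φ.fv, V w = V' w) :
    φ.sat X α V ↔ φ.sat X α V' := by
  induction φ generalizing V V' with
  | subset a b => simp [sat, h a (Or.inl rfl), h b (Or.inr rfl)]
  | lift i v =>
    have : (fun k => V (v k)) = fun k => V' (v k) := funext fun k => h _ ⟨k, rfl⟩
    simp only [sat, this]
  | neg φ ih => exact not_congr (ih h)
  | or φ ψ ih₁ ih₂ =>
    exact or_congr (ih₁ fun w hw => h w (Or.inl hw)) (ih₂ fun w hw => h w (Or.inr hw))
  | ex w φ ih =>
    refine exists_congr fun Z => ih fun w' hw' => ?_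
    by_cases hww : w' = w
    · simp [updW, hww]
    · simpa [updW, hww] using h w' ⟨hw', hww⟩

/-- Existential quantification over a list of variables. -/
def SOForm.exs {W : Type} (l : List W) (φ : SOForm F W) : SOForm F W :=
  l.foldr SOForm.ex φ

theorem SOForm.sat_exs {W : Type} (l : List W) (φ : SOForm F W) {X : Type} (α : T.obj X)
    (V : W → Set X) :
    (φ.exs l).sat X α V ↔ ∃ V', (∀ w, w ∉ l → V' w = V w) ∧ φ.sat X α V' := by
  induction l generalizing V with
  | nil =>
    constructor
    · exact fun h => ⟨V, fun _ _ => rfl, h⟩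
    · rintro ⟨V', h, h'⟩
      rwa [show V' = V from funext fun w => h w (by simp)] at h'
  | cons w l ih =>
    change (∃ Z, (φ.exs l).sat X α (updW V w Z)) ↔ _
    simp only [ih]
    constructor
    · rintro ⟨Z, V', h, h'⟩
      refine ⟨V', fun w' hw' => ?_, h'⟩
      simp only [List.mem_cons, not_or] at hw'
      simp [h w' hw'.2, updW, hw'.1]
    · rintro ⟨V', h, h'⟩
      refine ⟨V' w, V', fun w' hw' => ?_, h'⟩
      by_cases hww : w' = w
      · simp [updW, hww]
      · simp [updW, hww, h w' (by simp [hww, hw'])]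

theorem SOForm.fv_exs {W : Type} (l : List W) (φ : SOForm F W) :
    (φ.exs l).fv ⊆ {w ∈ φ.fv | w ∉ l} := by
  induction l with
  | nil => intro w hw; exact ⟨hw, by simp⟩
  | cons w l ih =>
    rintro x ⟨hx, hxw⟩
    obtain ⟨h₁, h₂⟩ := ih hx
    exact ⟨h₁, by simpa using ⟨hxw, h₂⟩⟩

/-- A property of one-step models is definable if some one-step second-order sentence
expresses it. -/
def OneStepDefinable (F : LiftingFamily T) (B : Type)
    (P : (X : Type) → T.obj X → (B → Set X) → Prop) : Prop :=
  ∃ φ : SOForm F (B ⊕ ℕ), IsSentence φ ∧ ∀ X α V, φ.sat0 X α V ↔ P X α V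

namespace OneStepDefinable

variable {A B C : Type}

theorem congr {P Q : (X : Type) → T.obj X → (B → Set X) → Prop}
    (hP : OneStepDefinable F B P) (h : ∀ X α V, P X α V ↔ Q X α V) :
    OneStepDefinable F B Q := by
  obtain ⟨φ, hs, hφ⟩ := hP
  exact ⟨φ, hs, fun X α V => (hφ X α V).trans (h X α V)⟩

theorem subset (a b : B) : OneStepDefinable F B (fun _ _ V => V a ⊆ V b) := by
  refine ⟨.subset (Sum.inl a) (Sum.inl b), ?_, fun _ _ _ => Iff.rfl⟩
  rintro w (rfl | rfl)
  exacts [⟨_, rfl⟩, ⟨_, rfl⟩]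

theorem not {P : (X : Type) → T.obj X → (B → Set X) → Prop} (hP : OneStepDefinable F B P) :
    OneStepDefinable F B (fun X α V => ¬ P X α V) := by
  obtain ⟨φ, hs, hφ⟩ := hP
  exact ⟨.neg φ, hs, fun X α V => not_congr (hφ X α V)⟩

theorem or {P Q : (X : Type) → T.obj X → (B → Set X) → Prop} (hP : OneStepDefinable F B P)
    (hQ : OneStepDefinable F B Q) :
    OneStepDefinable F B (fun X α V => P X α V ∨ Q X α V) := by
  obtain ⟨φ, hs, hφ⟩ := hP
  obtain ⟨ψ, ht, hψ⟩ := hQ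
  refine ⟨.or φ ψ, ?_, fun X α V => or_congr (hφ X α V) (hψ X α V)⟩
  rintro w (hw | hw)
  exacts [hs w hw, ht w hw]

theorem and {P Q : (X : Type) → T.obj X → (B → Set X) → Prop} (hP : OneStepDefinable F B P)
    (hQ : OneStepDefinable F B Q) :
    OneStepDefinable F B (fun X α V => P X α V ∧ Q X α V) :=
  (hP.not.or hQ.not).not.congr fun X α V => by tauto

theorem rename {P : (X : Type) → T.obj X → (A → Set X) → Prop} (hP : OneStepDefinable F A P)
    {f : A → B} (hf : Function.Injective f) :
    OneStepDefinable F B (fun X α V => P X α (V ∘ f)) := by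
  obtain ⟨φ, hs, hφ⟩ := hP
  refine ⟨φ.rename (Sum.map f id), fun w hw => ?_, fun X α V => ?_⟩
  · obtain ⟨y, hy, rfl⟩ := SOForm.fv_rename _ _ hw
    obtain ⟨a, rfl⟩ := hs y hy
    exact ⟨f a, rfl⟩
  · refine Iff.trans ?_ (hφ X α (V ∘ f))
    rw [SOForm.sat0, SOForm.sat_rename (hf.sumMap Function.injective_id), SOForm.sat0]
    refine φ.sat_congr α fun w hw => ?_
    obtain ⟨a, rfl⟩ := hs w hw
    rfl

theorem exists_sum [Finite C] {P : (X : Type) → T.obj X → ((B ⊕ C) → Set X) → Prop}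
    (hP : OneStepDefinable F (B ⊕ C) P) :
    OneStepDefinable F B (fun X α V => ∃ W : C → Set X, P X α (Sum.elim V W)) := by
  obtain ⟨φ, hs, hφ⟩ := hP
  have := Fintype.ofFinite C
  have : Countable C := Finite.to_countable
  obtain ⟨enc, henc⟩ := exists_injective_nat (C ⊕ ℕ)
  let f : (B ⊕ C) ⊕ ℕ → B ⊕ ℕ :=
    Sum.elim (Sum.elim Sum.inl fun c => Sum.inr (enc (Sum.inl c))) fun n => Sum.inr (enc (Sum.inr n))
  have hf : Function.Injective f := by
    rintro ((a | a) | a) ((b | b) | b) h <;> simp [f, henc.eq_iff] at h ⊢ <;> exact h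
  let l : List (B ⊕ ℕ) := Finset.univ.toList.map fun c : C => Sum.inr (enc (Sum.inl c))
  have hl : ∀ w, w ∈ l ↔ ∃ c : C, Sum.inr (enc (Sum.inl c)) = w := by simp [l]
  refine ⟨(φ.rename f).exs l, fun w hw => ?_, fun X α V => ?_⟩
  · obtain ⟨hw₁, hw₂⟩ := SOForm.fv_exs _ _ hw
    obtain ⟨y, hy, rfl⟩ := SOForm.fv_rename _ _ hw₁
    obtain ⟨b | c, rfl⟩ := hs y hy
    · exact ⟨b, rfl⟩
    · exact absurd ((hl _).2 ⟨c, rfl⟩) hw₂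
  · have key : ∀ V' : B ⊕ ℕ → Set X, (φ.rename f).sat X α V' ↔
        P X α (fun x => V' (f (Sum.inl x))) := by
      intro V'
      rw [SOForm.sat_rename hf, ← hφ, SOForm.sat0]
      refine φ.sat_congr α fun w hw => ?_
      obtain ⟨a, rfl⟩ := hs w hw
      rfl
    rw [SOForm.sat0, SOForm.sat_exs]
    simp only [key]
    constructor
    · rintro ⟨V', h, h'⟩
      refine ⟨fun c => V' (Sum.inr (enc (Sum.inl c))), ?_⟩
      convert h' using 1
      funext x
      rcases x with b | c
      · exact (h (Sum.inl b) (by simp [l])).symm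
      · rfl
    · rintro ⟨W, h⟩
      refine ⟨fun w => if h : ∃ c : C, Sum.inr (enc (Sum.inl c)) = w then W h.choose
        else Sum.elim V (fun _ => ∅) w, fun w hw => ?_, ?_⟩
      · rw [hl] at hw
        simp [hw]
      · convert h using 1
        funext x
        rcases x with b | c
        · simp [f]
        · have hc : ∃ c' : C, (Sum.inr (enc (Sum.inl c')) : B ⊕ ℕ) = f (Sum.inl (Sum.inr c)) :=
            ⟨c, rfl⟩
          exact (dif_pos hc).trans (congrArg W
            (Sum.inl_injective (henc (Sum.inr_injective hc.choose_spec))))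

theorem forall_set {P : (X : Type) → T.obj X → ((B ⊕ Unit) → Set X) → Prop}
    (hP : OneStepDefinable F (B ⊕ Unit) P) :
    OneStepDefinable F B (fun X α V => ∀ Z : Set X, P X α (Sum.elim V fun _ => Z)) := by
  refine (hP.not.exists_sum.not).congr fun X α V => ?_
  push Not
  exact ⟨fun h Z => h _, fun h W => h (W ())⟩

theorem empty (b : B) : OneStepDefinable F B (fun _ _ V => V b = ∅) := by
  refine (subset (Sum.inl b) (Sum.inr ())).forall_set.congr fun X α V => ?_
  exact ⟨fun h => Set.subset_empty_iff.1 (h ∅), fun h Z => by simp [h]⟩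

theorem disjoint (a b : B) : OneStepDefinable F B (fun _ _ V => Disjoint (V a) (V b)) := by
  refine (((subset (Sum.inr ()) (Sum.inl a)).and (subset (Sum.inr ()) (Sum.inl b))).not.or
    (empty (Sum.inr ()))).forall_set.congr fun X α V => ?_
  simp only [Sum.elim_inl, Sum.elim_inr, Set.disjoint_iff_inter_eq_empty]
  constructor
  · intro h
    exact (h (V a ∩ V b)).resolve_left (by simp)
  · intro h Z
    by_contra! hc
    obtain ⟨x, hx⟩ := hc.2
    exact Set.notMem_empty x (h ▸ ⟨hc.1.1 hx, hc.1.2 hx⟩)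

theorem true : OneStepDefinable F B (fun _ _ _ => True) := by
  refine (subset (Sum.inr ()) (Sum.inr ())).forall_set.congr fun X α V => by simp

theorem imp (p : Prop) {P : (X : Type) → T.obj X → (B → Set X) → Prop}
    (hP : OneStepDefinable F B P) :
    OneStepDefinable F B (fun X α V => p → P X α V) := by
  by_cases h : p
  · exact hP.congr fun _ _ _ => by simp [h]
  · exact true.congr fun _ _ _ => by simp [h]

theorem forall_finite {ι : Type} [Finite ι]
    {P : ι → (X : Type) → T.obj X → (B → Set X) → Prop}
    (hP : ∀ i, OneStepDefinable F B (P i)) :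
    OneStepDefinable F B (fun X α V => ∀ i, P i X α V) := by
  have := Fintype.ofFinite ι
  have key : ∀ s : Finset ι, OneStepDefinable F B (fun X α V => ∀ i ∈ s, P i X α V) := by
    intro s
    induction s using Finset.induction_on with
    | empty => exact true.congr fun _ _ _ => by simp
    | insert a s _ ih => exact ((hP a).and ih).congr fun _ _ _ => by simp
  exact (key Finset.univ).congr fun _ _ _ => by simp

theorem eq_iUnion [Finite B] (p : B → Prop) (b₀ : B) :
    OneStepDefinable F B (fun _ _ V => V b₀ = {x | ∃ b, p b ∧ x ∈ V b}) := by
  refine ((forall_finite fun b => imp (p b) (subset b b₀)).and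
    ((subset (Sum.inr ()) (Sum.inl b₀)).not.or ((forall_finite fun b : B => imp (p b)
      (disjoint (Sum.inr ()) (Sum.inl b))).not.or (empty (Sum.inr ())))).forall_set).congr
    fun X α V => ?_
  simp only [Sum.elim_inl, Sum.elim_inr]
  constructor
  · rintro ⟨h₁, h₂⟩
    ext x
    constructor
    · intro hx
      by_contra hc
      rcases h₂ {x} with h | h | h
      · exact h (by simpa using hx)
      · refine h fun b hb => ?_
        rw [Set.disjoint_singleton_left]
        exact fun hxb => hc ⟨b, hb, hxb⟩
      · simp at h
    · rintro ⟨b, hb, hx⟩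
      exact h₁ b hb hx
  · intro h
    refine ⟨fun b hb x hx => h ▸ ⟨b, hb, hx⟩, fun Z => ?_⟩
    by_contra! hc
    obtain ⟨hZ, hd, x, hx⟩ := hc
    have := hZ hx
    rw [h] at this
    obtain ⟨b, hb, hxb⟩ := this
    exact Set.disjoint_left.1 (hd b hb) hx hxb

theorem subst_iUnion [Finite A] [Finite B]
    {P : (X : Type) → T.obj X → (A → Set X) → Prop} (hP : OneStepDefinable F A P)
    (p : A → B → Prop) :
    OneStepDefinable F B (fun X α V => P X α fun a => {x | ∃ b, p a b ∧ x ∈ V b}) := by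
  refine ((forall_finite fun a : A => eq_iUnion (Sum.elim (p a) fun _ => False)
    (Sum.inr a : B ⊕ A)).and (hP.rename Sum.inr_injective)).exists_sum.congr fun X α V => ?_
  have : ∀ W : A → Set X, (Sum.elim V W) ∘ Sum.inr = W := fun W => rfl
  simp only [Sum.elim_inr, this, Sum.exists, Sum.elim_inl, false_and, exists_false, or_false,
    ← funext_iff]
  exact ⟨fun ⟨W, h, h'⟩ => h ▸ h', fun h => ⟨_, rfl, h⟩⟩

end OneStepDefinable

end OneStep

section LatestAppearance

variable {L : Type}

/-- The latest appearance memory after reading `x`: it maps each letter `z` to the set of letters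
that occurred since the last occurrence of `z`. -/
noncomputable def larUpdate (m : L → Set L) (x : L) : L → Set L :=
  fun z => if z = x then ∅ else insert x (m z)

/-- The letters seen since the previous occurrence of `x`, including `x` itself. -/
def larHit (m : L → Set L) (x : L) : Set L := insert x (m x)

/-- The parity assigned to reading `x` in memory `m`, for the Muller condition `G`. -/
noncomputable def larPriority (G : Set L → Prop) (m : L → Set L) (x : L) : ℕ :=
  2 * (larHit m x).ncard + if G (larHit m x) then 0 else 1

/-- The set of values that a sequence takes infinitely often. -/
def infOften (x : ℕ → L) : Set L := {y | ∃ᶠ i in Filter.atTop, x i = y}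

theorem mem_larMemory {x : ℕ → L} {m : ℕ → L → Set L} (h₀ : m 0 = fun _ => ∅)
    (hm : ∀ i, m (i + 1) = larUpdate (m i) (x i)) (i : ℕ) (y z : L) :
    y ∈ m i z ↔ ∃ j < i, x j = y ∧ ∀ j', j ≤ j' → j' < i → x j' ≠ z := by
  induction i with
  | zero => simp [h₀]
  | succ i ih =>
    rw [hm, larUpdate]
    split_ifs with hz
    · simp only [Set.mem_empty_iff_false, false_iff, not_exists, not_and]
      intro j hj _ h
      exact h i (by omega) (by omega) hz.symm
    · rw [Set.mem_insert_iff, ih]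
      constructor
      · rintro (rfl | ⟨j, hj, hy, h⟩)
        · exact ⟨i, by omega, rfl, fun j' h₁ h₂ => by
            obtain rfl : j' = i := by omega
            exact Ne.symm hz⟩
        · refine ⟨j, by omega, hy, fun j' h₁ h₂ => ?_⟩
          rcases (by omega : j' < i ∨ j' = i) with h' | rfl
          exacts [h j' h₁ h', Ne.symm hz]
      · rintro ⟨j, hj, hy, h⟩
        rcases (by omega : j < i ∨ j = i) with h' | rfl
        · exact Or.inr ⟨j, h', hy, fun j' h₁ h₂ => h j' h₁ (by omega)⟩
        · exact Or.inl hy.symm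

theorem eventually_mem_infOften [Finite L] (x : ℕ → L) :
    ∀ᶠ i in Filter.atTop, x i ∈ infOften x := by
  have h : ∀ y : L, ∀ᶠ i in Filter.atTop, x i = y → y ∈ infOften x := by
    intro y
    by_cases hy : y ∈ infOften x
    · exact .of_forall fun _ _ => hy
    · filter_upwards [Filter.not_frequently.1 hy] with i hi h
      exact absurd h hi
  filter_upwards [Filter.eventually_all.2 h] with i hi using hi _ rfl

theorem eventually_larHit_subset [Finite L] {x : ℕ → L} {m : ℕ → L → Set L}
    (h₀ : m 0 = fun _ => ∅) (hm : ∀ i, m (i + 1) = larUpdate (m i) (x i)) :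
    ∀ᶠ i in Filter.atTop, larHit (m i) (x i) ⊆ infOften x := by
  obtain ⟨i₀, hi₀⟩ := Filter.eventually_atTop.1 (eventually_mem_infOften x)
  have h : ∀ y : L, ∀ᶠ i in Filter.atTop, y ∈ infOften x → ∃ j, i₀ ≤ j ∧ j < i ∧ x j = y := by
    intro y
    by_cases hy : y ∈ infOften x
    · obtain ⟨j, hj, hxj⟩ := Filter.frequently_atTop.1 hy i₀
      filter_upwards [Filter.eventually_gt_atTop j] with i hi _ using ⟨j, hj, hi, hxj⟩
    · exact .of_forall fun _ h => absurd h hy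
  filter_upwards [Filter.eventually_all.2 h, Filter.eventually_ge_atTop i₀] with i hi hii
  rintro y (rfl | hy)
  · exact hi₀ i hii
  · obtain ⟨j, hj, rfl, hlast⟩ := (mem_larMemory h₀ hm i y _).1 hy
    obtain ⟨j', h₁, h₂, h₃⟩ := hi _ (hi₀ i hii)
    refine hi₀ j ?_
    by_contra! hlt
    exact hlast j' (by omega) h₂ h₃

theorem frequently_larHit_eq [Finite L] {x : ℕ → L} {m : ℕ → L → Set L}
    (h₀ : m 0 = fun _ => ∅) (hm : ∀ i, m (i + 1) = larUpdate (m i) (x i)) :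
    ∃ᶠ i in Filter.atTop, larHit (m i) (x i) = infOften x := by
  obtain ⟨i₀, hi₀⟩ := Filter.eventually_atTop.1 (eventually_larHit_subset h₀ hm)
  rw [Filter.frequently_atTop]
  intro i₁
  set i := max i₀ i₁
  have hex : ∀ y : infOften x, ∃ j, i ≤ j ∧ x j = y := fun y =>
    Filter.frequently_atTop.1 y.2 i
  have hne : Nonempty (infOften x) :=
    let ⟨j, hj⟩ := (eventually_mem_infOften x).exists; ⟨⟨x j, hj⟩⟩
  obtain ⟨y, hy⟩ := Finite.exists_max fun y => Nat.find (hex y)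
  obtain ⟨hn₁, hn₂⟩ := Nat.find_spec (hex y)
  set n := Nat.find (hex y) with hn
  refine ⟨n, by omega, (hi₀ n (by omega)).antisymm fun z hz => ?_⟩
  obtain ⟨hz₁, hz₂⟩ := Nat.find_spec (hex ⟨z, hz⟩)
  have hzn := hy ⟨z, hz⟩
  set nz := Nat.find (hex ⟨z, hz⟩)
  simp only at hz₂ hzn
  by_cases hzy : z = x n
  · exact Or.inl hzy
  refine Or.inr ((mem_larMemory h₀ hm n z _).2 ⟨nz, lt_of_le_of_ne hzn ?_, hz₂, ?_⟩)
  · rintro h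
    exact hzy (h ▸ hz₂.symm)
  · intro j h₁ h₂ h
    exact Nat.find_min (hex y) h₂ ⟨by omega, h.trans hn₂⟩

/-- The latest appearance record turns a Muller condition into a parity condition. -/
theorem larPriority_parity_iff [Finite L] (G : Set L → Prop) {x : ℕ → L} {m : ℕ → L → Set L}
    (h₀ : m 0 = fun _ => ∅) (hm : ∀ i, m (i + 1) = larUpdate (m i) (x i)) :
    (∃ n : ℕ, Even n ∧ (∃ᶠ i in Filter.atTop, larPriority G (m i) (x i) = n) ∧
      ∀ k : ℕ, (∃ᶠ i in Filter.atTop, larPriority G (m i) (x i) = k) → k ≤ n) ↔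
    G (infOften x) := by
  set I := infOften x
  set N := 2 * I.ncard + if G I then 0 else 1 with hN
  have hfreq : ∃ᶠ i in Filter.atTop, larPriority G (m i) (x i) = N :=
    (frequently_larHit_eq h₀ hm).mono fun i hi => by rw [larPriority, hi]
  have hev : ∀ᶠ i in Filter.atTop, larPriority G (m i) (x i) ≤ N := by
    filter_upwards [eventually_larHit_subset h₀ hm] with i hi
    rcases hi.eq_or_ssubset with h | h
    · rw [larPriority, h]
    · have : (larHit (m i) (x i)).ncard < I.ncard := Set.ncard_lt_ncard h (Set.toFinite _)
      rw [larPriority, hN]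
      split_ifs <;> omega
  have hle : ∀ k, (∃ᶠ i in Filter.atTop, larPriority G (m i) (x i) = k) → k ≤ N := by
    intro k hk
    obtain ⟨i, h₁, h₂⟩ := (hk.and_eventually hev).exists
    omega
  have hpar : Even N ↔ G I := by
    rw [hN]
    split_ifs with h <;> simp [h]
  constructor
  · rintro ⟨n, hn, hnf, hnmax⟩
    rwa [← hpar, ← (hle n hnf).antisymm (hnmax N hfreq)]
  · exact fun h => ⟨N, hpar.2 h, hfreq, hle⟩

end LatestAppearance

section Registers

theorem Finset.exists_injOn_extend {α β : Type*} [DecidableEq α] [DecidableEq β] {s u : Finset α}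
    {t : Finset β} (hus : u ⊆ s) (hcard : s.card ≤ t.card) {f : α → β} (hf : Set.InjOn f u)
    (hft : ∀ x ∈ u, f x ∈ t) :
    ∃ g : α → β, Set.InjOn g s ∧ (∀ x ∈ s, g x ∈ t) ∧ ∀ x ∈ u, g x = f x := by
  have hft' : u.image f ⊆ t := by
    intro y hy
    obtain ⟨x, hx, rfl⟩ := Finset.mem_image.1 hy
    exact hft x hx
  have hcu : (u.image f).card ≤ s.card :=
    Finset.card_image_le.trans (Finset.card_le_card hus)
  obtain ⟨t', hut', ht't, hcard'⟩ := Finset.exists_subsuperset_card_eq hft' hcu hcard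
  have hmaps : Set.MapsTo (fun x : s => f x) {x : s | (x : α) ∈ u} t' := fun x hx =>
    hut' (Finset.mem_image_of_mem f hx)
  obtain ⟨e, he⟩ := hmaps.exists_equiv_extend_of_card_eq (by simpa using hcard'.symm)
    fun a ha b hb hab => Subtype.ext (hf ha hb hab)
  have hval : ∀ x (hx : x ∈ s), (if h : x ∈ s then (e ⟨x, h⟩ : β) else f x) = e ⟨x, hx⟩ :=
    fun x hx => dif_pos hx
  refine ⟨fun x => if h : x ∈ s then e ⟨x, h⟩ else f x, fun a ha b hb hab => ?_, fun x hx => ?_,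
    fun x hx => ?_⟩
  · simp only [hval a ha, hval b hb] at hab
    simpa using e.injective (Subtype.ext hab)
  · simp only [hval x hx]
    exact ht't (e ⟨x, hx⟩).2
  · simp only [hval x (hus hx)]
    exact he ⟨x, hus hx⟩ hx

/-- One step of the register construction for the values `S`: registers move down to the largest
value not exceeding their content, merging into the register of smallest name, and fresh registers
are allocated for the remaining values. The register `j` is renamed to `g j`. -/
structure IsRegisterStep {O : Type*} [LinearOrder O] {n : ℕ} (r : Fin (n + 1) → WithBot O)
    (S : Set O) (r' : Fin (n + 1) → WithBot O) (g : Fin (n + 1) → Fin (n + 1)) : Prop where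
  name_le : ∀ j, g j ≤ j
  value_le : ∀ j, r' (g j) ≤ r j
  le_value : ∀ x ∈ S, ∀ j, (x : WithBot O) ≤ r j → (x : WithBot O) ≤ r' (g j)
  exists_eq : ∀ x ∈ S, ∃ j, r' j = x
  eq_bot_or : ∀ j, r' j = ⊥ ∨ ∃ x ∈ S, r' j = x

theorem exists_isRegisterStep {O : Type*} [LinearOrder O] {n : ℕ} (r : Fin (n + 1) → WithBot O)
    (hr : r 0 = ⊥) (S : Finset O) (hS : S.card ≤ n) :
    ∃ (r' : Fin (n + 1) → WithBot O) (g : Fin (n + 1) → Fin (n + 1)),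
      r' 0 = ⊥ ∧ IsRegisterStep r S r' g := by
  have hF : ∀ j, ∃ y : WithBot O, y ≤ r j ∧ (y = ⊥ ∨ ∃ x ∈ S, y = x) ∧
      ∀ x ∈ S, (x : WithBot O) ≤ r j → x ≤ y := by
    intro j
    by_cases h : (S.filter fun x : O => (x : WithBot O) ≤ r j).Nonempty
    · refine ⟨(S.filter fun x : O => (x : WithBot O) ≤ r j).max' h, ?_, Or.inr ⟨_, ?_, rfl⟩, ?_⟩
      · exact (Finset.mem_filter.1 (Finset.max'_mem _ h)).2
      · exact (Finset.mem_filter.1 (Finset.max'_mem _ h)).1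
      · intro x hx hxr
        exact WithBot.coe_le_coe.2 (Finset.le_max' _ _ (Finset.mem_filter.2 ⟨hx, hxr⟩))
    · refine ⟨⊥, bot_le, Or.inl rfl, fun x hx hxr => ?_⟩
      exact absurd ⟨x, Finset.mem_filter.2 ⟨hx, hxr⟩⟩ h
  choose y hyr hyS hmax using hF
  have hy0 : y 0 = ⊥ := le_bot_iff.1 (hr ▸ hyr 0)
  have hN : ∀ x : O, ∃ i : Fin (n + 1), (∃ j, y j = x) → y i = x ∧ ∀ j, y j = x → i ≤ j := by
    intro x
    by_cases h : ∃ j, y j = x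
    · have hne : (Finset.univ.filter fun j => y j = x).Nonempty :=
        let ⟨j, hj⟩ := h; ⟨j, by simp [hj]⟩
      refine ⟨(Finset.univ.filter fun j => y j = x).min' hne, fun _ => ⟨?_, fun j hj => ?_⟩⟩
      · simpa using Finset.min'_mem _ hne
      · exact Finset.min'_le _ _ (by simp [hj])
    · exact ⟨0, fun h' => absurd h' h⟩
  choose ν₀ hν₀ using hN
  obtain ⟨ν, hinj, hne, hext⟩ := Finset.exists_injOn_extend
    (s := S) (u := S.filter fun x => ∃ j, y j = x) (t := Finset.univ.erase (0 : Fin (n + 1)))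
    (Finset.filter_subset _ _) (by simpa using hS) (f := ν₀)
    (by
      intro a ha b hb hab
      have ha' := (hν₀ a (Finset.mem_filter.1 ha).2).1
      have hb' := (hν₀ b (Finset.mem_filter.1 hb).2).1
      rw [hab, hb'] at ha'
      exact (WithBot.coe_injective ha').symm)
    (by
      intro a ha
      have ha' := (hν₀ a (Finset.mem_filter.1 ha).2).1
      refine Finset.mem_erase.2 ⟨fun h => ?_, Finset.mem_univ _⟩
      rw [h, hy0] at ha'
      exact WithBot.bot_ne_coe ha')
  have hr' : ∀ j, ∃ z : WithBot O, (z = ⊥ ∨ ∃ x ∈ S, z = x) ∧ (j = 0 → z = ⊥) ∧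
      ∀ x ∈ S, ν x = j → z = x := by
    intro j
    by_cases h : ∃ x ∈ S, ν x = j
    · obtain ⟨x, hx, rfl⟩ := h
      refine ⟨x, Or.inr ⟨x, hx, rfl⟩, fun h => absurd h (Finset.ne_of_mem_erase (hne x hx)),
        fun x' hx' h => ?_⟩
      rw [hinj hx' hx h]
    · exact ⟨⊥, Or.inl rfl, fun _ => rfl, fun x hx hxj => absurd ⟨x, hx, hxj⟩ h⟩
  choose r' hr'S hr'0 hr'ν using hr'
  have hg : ∀ j, ∃ i ≤ j, r' i = y j := by
    intro j
    rcases hyS j with h | ⟨x, hx, h⟩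
    · exact ⟨0, Fin.zero_le _, by rw [h, hr'0 0 rfl]⟩
    · refine ⟨ν x, ?_, by rw [h, hr'ν _ x hx rfl]⟩
      rw [hext x (Finset.mem_filter.2 ⟨hx, j, h⟩)]
      exact (hν₀ x ⟨j, h⟩).2 j h
  choose g hgle hg using hg
  exact ⟨r', g, hr'0 0 rfl, hgle, fun j => (hg j).trans_le (hyr j),
    fun x hx j h => (hmax j x hx h).trans_eq (hg j).symm,
    fun x hx => ⟨ν x, hr'ν _ x hx rfl⟩, hr'S⟩

/-- Registers can be maintained along all branches of a tree. -/
theorem exists_registers {ι O : Type*} [LinearOrder O] {n : ℕ} (S : ι → Finset O)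
    (hS : ∀ s, (S s).card ≤ n) :
    ∃ (r : List ι → Fin (n + 1) → WithBot O) (g : List ι → Fin (n + 1) → Fin (n + 1)),
      ∀ s l, IsRegisterStep (r l) (S s) (r (s :: l)) (g (s :: l)) := by
  choose r' g hr' hstep using fun (r : {r : Fin (n + 1) → WithBot O // r 0 = ⊥}) s =>
    exists_isRegisterStep r.1 r.2 (S s) (hS s)
  let ρ : List ι → {r : Fin (n + 1) → WithBot O // r 0 = ⊥} :=
    List.foldr (fun s r => ⟨r' r s, hr' r s⟩) ⟨fun _ => ⊥, rfl⟩
  exact ⟨fun l => (ρ l).1, fun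
    | [] => id
    | s :: l => g (ρ l) s,
    fun s l => hstep (ρ l) s⟩

theorem IsRegisterStep.eventually_eq {O : Type*} [LinearOrder O] [WellFoundedLT O] {n : ℕ}
    {r : ℕ → Fin (n + 1) → WithBot O} {S : ℕ → Set O} {g : ℕ → Fin (n + 1) → Fin (n + 1)}
    (h : ∀ i, IsRegisterStep (r i) (S i) (r (i + 1)) (g i)) {j : Fin (n + 1)}
    (hj : ∀ᶠ i in Filter.atTop, g i j = j) :
    ∀ᶠ i in Filter.atTop, r (i + 1) j = r i j := by
  obtain ⟨i₀, hi₀⟩ := Filter.eventually_atTop.1 hj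
  have hanti : Antitone fun i => r (i₀ + i) j := antitone_nat_of_succ_le fun i => by
    have := (h (i₀ + i)).value_le j
    rwa [hi₀ _ (by omega)] at this
  obtain ⟨m, hm⟩ := WellFoundedLT.antitone_chain_condition hanti
  refine Filter.eventually_atTop.2 ⟨i₀ + m, fun i hi => ?_⟩
  obtain ⟨d, rfl⟩ := Nat.exists_eq_add_of_le hi
  have h₁ := hm (m + d) (by omega)
  have h₂ := hm (m + d + 1) (by omega)
  simp only [← add_assoc] at h₁ h₂
  rw [← h₁, ← h₂]

end Registers

section Histories

theorem histPrefix_succ {α : Type} (f : ℕ → α) (n : ℕ) :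
    histPrefix f (n + 1) = f (n + 1) :: histPrefix f n := by
  simp [histPrefix, List.range_succ]

theorem histPrefix_suffix {α : Type} (f : ℕ → α) {m n : ℕ} (h : m ≤ n) :
    histPrefix f m <:+ histPrefix f n := by
  induction n, h using Nat.le_induction with
  | base => exact List.suffix_rfl
  | succ n _ ih => exact histPrefix_succ f n ▸ ih.trans (List.suffix_cons _ _)

theorem histPrefix_eq_cons {α : Type} (f : ℕ → α) (n : ℕ) :
    ∃ l, histPrefix f n = f n :: l := by
  cases n with
  | zero => exact ⟨[], rfl⟩
  | succ n => exact ⟨_, histPrefix_succ f n⟩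

/-- A sequence of lists of unbounded length, each a suffix of the next, has a limit. -/
theorem exists_limit_of_suffix_chain {α : Type} (c : ℕ → List α) (hlen : ∀ i, i < (c i).length)
    (hc : ∀ i, c i <:+ c (i + 1)) :
    ∃ f : ℕ → α, ∀ i, c i = histPrefix f ((c i).length - 1) := by
  have hc' : ∀ i j, i ≤ j → c i <:+ c j := fun i j hij => by
    induction j, hij using Nat.le_induction with
    | base => exact List.suffix_rfl
    | succ n _ ih => exact ih.trans (hc n)
  have hget : ∀ i m, m < (c i).length →
      (c i).reverse[m]? = (c m).reverse[m]? := by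
    intro i m him
    have key : ∀ i j, i ≤ j → m < (c i).length → (c i).reverse[m]? = (c j).reverse[m]? := by
      intro i j hij hi
      obtain ⟨t, ht⟩ := hc' i j hij
      rw [← ht, List.reverse_append, List.getElem?_append_left (by simpa using hi)]
    rcases le_total i m with h | h
    · exact key i m h him
    · exact (key m i h (hlen m)).symm
  refine ⟨fun m => (c m).reverse[m]'(by simpa using hlen m), fun i => ?_⟩
  rw [← List.reverse_inj, histPrefix, List.reverse_reverse]
  have hi := hlen i
  refine List.ext_getElem? fun m => ?_
  by_cases hm : m < (c i).length
  · have hm' : m < (c i).length - 1 + 1 := by omega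
    rw [hget i m hm]
    simp [List.getElem?_range hm', hlen m]
  · rw [List.getElem?_eq_none (by simpa using hm), List.getElem?_eq_none (by simp; omega)]

variable {T : SetFunctor} {F : LiftingFamily T} {aut : SOAutomaton T F} {M : TreeModel T}
  {st : List (aut.St × M.S) → aut.St → Set M.S}

theorem SOReach.ne_nil {h : List (aut.St × M.S)} (hr : SOReach aut M st h) : h ≠ [] := by
  cases hr <;> simp

theorem SOReach.of_suffix {h : List (aut.St × M.S)} (hr : SOReach aut M st h)
    {h' : List (aut.St × M.S)} (hs : h' <:+ h) (hne : h' ≠ []) : SOReach aut M st h' := by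
  induction hr with
  | base =>
    rcases List.suffix_cons_iff.1 hs with rfl | hs
    · exact .base
    · exact absurd (List.suffix_nil.1 hs) hne
  | step hr hq ih =>
    rcases List.suffix_cons_iff.1 hs with rfl | hs
    · exact .step hr hq
    · exact ih hs

theorem SOReach.mem_of_cons_cons {q p : aut.St × M.S} {h : List (aut.St × M.S)}
    (hr : SOReach aut M st (q :: p :: h)) : q.2 ∈ st (p :: h) q.1 := by
  cases hr with
  | step _ hq => exact hq

theorem SOReach.eq_of_singleton {p : aut.St × M.S}
    (hr : SOReach aut M st [p]) : p = (aut.aI, M.root) := by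
  cases hr with
  | base => rfl

theorem soReach_histPrefix {f : ℕ → aut.St × M.S} (h₀ : f 0 = (aut.aI, M.root))
    (hf : ∀ n, (f (n + 1)).2 ∈ st (histPrefix f n) (f (n + 1)).1) (n : ℕ) :
    SOReach aut M st (histPrefix f n) := by
  induction n with
  | zero => simpa [histPrefix, h₀] using SOReach.base
  | succ n ih =>
    rw [histPrefix_succ]
    have h := hf n
    obtain ⟨l, hl⟩ := histPrefix_eq_cons f n
    rw [hl] at ih h ⊢
    exact .step ih h

variable (st) in
/-- `h'` extends `h` by a segment with parities at most `k`, ending with a move made at a position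
of parity `k`. -/
def ParityRel (k : ℕ) (h' h : List (aut.St × M.S)) : Prop :=
  ∃ q e, h' = q :: (e ++ h) ∧ SOReach aut M st h' ∧ (∃ p l, e ++ h = p :: l ∧ aut.Ω p.1 = k) ∧
    (∀ y ∈ e, aut.Ω y.1 ≤ k) ∧ ∃ x t, h = x :: t ∧ aut.Ω x.1 ≤ k

theorem wellFounded_parityRel {k : ℕ} (hk : Odd k)
    (hwin : ∀ f : ℕ → aut.St × M.S, f 0 = (aut.aI, M.root) →
      (∀ n : ℕ, (f (n + 1)).2 ∈ st (histPrefix f n) (f (n + 1)).1) → aut.WinsParity M f) :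
    WellFounded (ParityRel st k) := by
  rw [wellFounded_iff_isEmpty_descending_chain]
  refine ⟨fun ⟨g, hg⟩ => ?_⟩
  have hlen : ∀ i, i < (g (i + 1)).length := by
    intro i
    induction i with
    | zero =>
      obtain ⟨q, e, h, -⟩ := hg 0
      simp [h]
    | succ i ih =>
      obtain ⟨q, e, h, -⟩ := hg (i + 1)
      rw [h]
      simp only [List.length_cons, List.length_append]
      omega
  have hreach : ∀ i, SOReach aut M st (g (i + 1)) := fun i => by
    obtain ⟨q, e, -, h, -⟩ := hg i
    exact h
  obtain ⟨f, hf⟩ := exists_limit_of_suffix_chain (fun i => g (i + 1)) hlen fun i => by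
    obtain ⟨q, e, h, -⟩ := hg (i + 1)
    exact ⟨q :: e, by simp [h]⟩
  have hsuf : ∀ m, SOReach aut M st (histPrefix f m) := fun m => by
    refine (hreach m).of_suffix ?_ ?_
    · rw [hf m]
      exact histPrefix_suffix f (Nat.le_sub_one_of_lt (hlen m))
    · obtain ⟨l, hl⟩ := histPrefix_eq_cons f m
      simp [hl]
  obtain ⟨n, hn, hfreq, hmax⟩ := hwin f (hsuf 0).eq_of_singleton fun n => by
    have := hsuf (n + 1)
    rw [histPrefix_succ] at this
    obtain ⟨l, hl⟩ := histPrefix_eq_cons f n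
    rw [hl] at this ⊢
    exact this.mem_of_cons_cons
  have hk_le : k ≤ n := by
    refine hmax k (Filter.frequently_atTop.2 fun i => ?_)
    obtain ⟨q, e, h, -, ⟨p, l, hpl, hpk⟩, -⟩ := hg (i + 1)
    have h₁ := hf (i + 1)
    have h₂ := hlen i
    have hl : (g (i + 1 + 1)).length = l.length + 1 + 1 := by simp [h, hpl]
    rw [hl, h, hpl, Nat.add_sub_cancel, histPrefix_succ] at h₁
    obtain ⟨l', hl'⟩ := histPrefix_eq_cons f l.length
    rw [hl', List.cons.injEq, List.cons.injEq] at h₁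
    have h₃ := congrArg List.length hpl
    simp only [List.length_append, List.length_cons] at h₃
    exact ⟨l.length, by omega, by rw [← h₁.2.1, hpk]⟩
  have hle_k : ∀ᶠ i in Filter.atTop, aut.Ω (f i).1 ≤ k := by
    obtain ⟨q, e, h, -, -, -, -⟩ := hg 0
    obtain ⟨t₀, ht₀⟩ : ∃ t₀, t₀ = e ++ g 0 := ⟨_, rfl⟩
    have hd : ∀ i, ∃ d, g (i + 1) = d ++ t₀ ∧ ∀ y ∈ d, aut.Ω y.1 ≤ k := by
      intro i
      induction i with
      | zero =>
        refine ⟨[q], by simp [h, ht₀], ?_⟩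
        obtain ⟨_, _, -, -, -, -, x, t, hx, hxk⟩ := hg 1
        rw [h, List.cons.injEq] at hx
        simpa [hx.1] using hxk
      | succ i ih =>
        obtain ⟨d, hd, hdk⟩ := ih
        obtain ⟨q', e', h', -, -, hek, -⟩ := hg (i + 1)
        obtain ⟨_, _, -, -, -, -, x, t, hx, hxk⟩ := hg (i + 1 + 1)
        refine ⟨q' :: (e' ++ d), by simp [h', hd], ?_⟩
        rw [h', List.cons.injEq] at hx
        simp only [List.mem_cons, List.mem_append]
        rintro y (rfl | hy | hy)
        exacts [hx.1 ▸ hxk, hek y hy, hdk y hy]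
    filter_upwards [Filter.eventually_ge_atTop t₀.length] with m hm
    obtain ⟨d, hd, hdk⟩ := hd m
    have h₁ := congrArg List.reverse (hf m)
    have h₂ := hlen m
    refine hdk _ ?_
    have h₃ := congrArg (fun l => l[m]?) h₁
    rw [histPrefix, List.reverse_reverse] at h₃
    simp only [List.getElem?_map,
      List.getElem?_range (show m < (g (m + 1)).length - 1 + 1 by omega), Option.map_some] at h₃
    rw [hd, List.reverse_append, List.getElem?_append_right (by simpa using hm)] at h₃
    simpa using List.mem_of_getElem? h₃
  obtain ⟨i, hi, hi'⟩ := (hfreq.and_eventually hle_k).exists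
  obtain rfl : k = n := by omega
  exact Nat.not_even_iff_odd.2 hk hn

/-- The truncation of a lexicographic signature to the components from `k` on. -/
noncomputable def truncSignature {N : ℕ} (k : Fin (N + 1)) (x : Colex (Fin (N + 1) → Ordinal.{0})) :
    Colex (Fin (N + 1) → Ordinal.{0}) :=
  toColex fun i => if k ≤ i then ofColex x i else 0

theorem truncSignature_monotone {N : ℕ} (k : Fin (N + 1)) : Monotone (truncSignature k) := by
  intro x y hxy
  rcases hxy.eq_or_lt with rfl | ⟨i, hi, hlt⟩
  · exact le_rfl
  by_cases hk : k ≤ i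
  · refine le_of_lt ⟨i, fun j hj => ?_, ?_⟩
    · change (if k ≤ j then x j else 0) = if k ≤ j then y j else 0
      rw [hi j hj]
    · change (if k ≤ i then x i else 0) < if k ≤ i then y i else 0
      simpa only [if_pos hk] using hlt
  · refine le_of_eq (congrArg toColex (funext fun j => ?_))
    split_ifs with hj
    · exact hi j (lt_of_lt_of_le (not_le.1 hk) hj)
    · rfl

theorem Acc.rank_le_rank {α : Type*} {r : α → α → Prop} {a b : α} (ha : Acc r a) (hb : Acc r b)
    (h : ∀ c, r c a → r c b) : ha.rank ≤ hb.rank := by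
  rw [ha.rank_eq]
  exact Ordinal.iSup_le fun c => Order.succ_le_of_lt (hb.rank_lt_of_rel (h _ c.2))

theorem ParityRel.of_cons {k : ℕ} {l h : List (aut.St × M.S)} {q p : aut.St × M.S}
    (hp : aut.Ω p.1 ≤ k) (hl : ParityRel st k l (q :: p :: h)) : ParityRel st k l (p :: h) := by
  obtain ⟨q', e, rfl, hr, ⟨p', l', hpl, hpk⟩, he, x, t, hx, hxk⟩ := hl
  obtain ⟨rfl, rfl⟩ := List.cons.inj hx
  refine ⟨q', e ++ [q], by simp, hr, ⟨p', l', by simpa using hpl, hpk⟩, fun y hy => ?_,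
    p, h, rfl, hp⟩
  rcases List.mem_append.1 hy with hy | hy
  · exact he y hy
  · rwa [List.mem_singleton.1 hy]

/-- A winning strategy can be made positional, with values from a well-founded order witnessing
that it is winning. -/
theorem SOAutomaton.Accepts.exists_positional (h : aut.Accepts M) (N : ℕ) :
    ∃ (O : Type 1) (_ : LinearOrder O) (_ : WellFoundedLT O) (W : Set (aut.St × M.S))
      (U : aut.St × M.S → aut.St → Set M.S) (v : Fin (N + 1) → aut.St × M.S → O),
      (aut.aI, M.root) ∈ W ∧ (∀ p ∈ W, aut.Legal M p.1 p.2 (U p)) ∧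
      ∀ p ∈ W, ∀ q : aut.St × M.S, q.2 ∈ U p q.1 → q ∈ W ∧
        ∀ k : Fin (N + 1), Odd (k : ℕ) → aut.Ω p.1 ≤ k →
          v k q ≤ v k p ∧ (aut.Ω p.1 = k → v k q < v k p) := by
  obtain ⟨st, hlegal, hwin⟩ := h
  have hwf : WellFoundedLT (Colex (Fin (N + 1) → Ordinal.{0})) :=
    Pi.Colex.wellFoundedLT (α := fun _ => Ordinal.{0})
  let rk : ℕ → List (aut.St × M.S) → Ordinal.{0} := fun k l =>
    if hk : Odd k then ((wellFounded_parityRel hk hwin).apply l).rank else 0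
  let sig : List (aut.St × M.S) → Colex (Fin (N + 1) → Ordinal.{0}) := fun l =>
    toColex fun i => rk i l
  let W : Set (aut.St × M.S) := {p | ∃ l, SOReach aut M st (p :: l)}
  have hmin : ∀ p : aut.St × M.S, ∃ l, p ∈ W → SOReach aut M st (p :: l) ∧
      ∀ l', SOReach aut M st (p :: l') → sig (p :: l) ≤ sig (p :: l') := by
    intro p
    by_cases hp : p ∈ W
    · obtain ⟨l, hl, hlmin⟩ := (InvImage.wf (fun l => sig (p :: l))
        (wellFounded_lt (α := Colex (Fin (N + 1) → Ordinal.{0})))).has_min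
        {l | SOReach aut M st (p :: l)} hp
      exact ⟨l, fun _ => ⟨hl, fun l' hl' => not_lt.1 (hlmin l' hl')⟩⟩
    · exact ⟨[], fun h => absurd h hp⟩
  choose H hH using hmin
  refine ⟨Colex (Fin (N + 1) → Ordinal.{0}), inferInstance, hwf, W, fun p => st (p :: H p),
    fun k p => truncSignature k (sig (p :: H p)), ⟨[], .base⟩,
    fun p hp => hlegal _ _ _ (hH p hp).1, fun p hp q hq => ?_⟩
  have hreach : SOReach aut M st (q :: p :: H p) := .step (hH p hp).1 hq
  have hqW : q ∈ W := ⟨_, hreach⟩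
  have hrk : ∀ k : ℕ, Odd k → aut.Ω p.1 ≤ k → rk k (q :: p :: H p) ≤ rk k (p :: H p) := by
    intro k hk hpk
    simp only [rk, dif_pos hk]
    exact Acc.rank_le_rank _ _ fun _ => ParityRel.of_cons hpk
  have hrk' : ∀ k : ℕ, Odd k → aut.Ω p.1 = k → rk k (q :: p :: H p) < rk k (p :: H p) := by
    intro k hk hpk
    simp only [rk, dif_pos hk]
    exact ((wellFounded_parityRel hk hwin).apply _).rank_lt_of_rel
      ⟨q, [], rfl, hreach, ⟨p, H p, rfl, hpk⟩, by simp, ⟨p, H p, rfl, hpk.le⟩⟩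
  have hle : ∀ k : Fin (N + 1), aut.Ω p.1 ≤ k → ∀ i : Fin (N + 1),
      (if k ≤ i then rk i (q :: p :: H p) else 0) ≤ if k ≤ i then rk i (p :: H p) else 0 := by
    intro k hpk i
    split_ifs with hki
    · by_cases hi : Odd (i : ℕ)
      · exact hrk i hi (hpk.trans hki)
      · simp [rk, hi]
    · exact le_rfl
  refine ⟨hqW, fun k hk hpk => ⟨?_, fun hpk' => ?_⟩⟩
  · exact (truncSignature_monotone k ((hH q hqW).2 _ hreach)).trans
      (Pi.toColex_monotone (hle k hpk))
  · refine (truncSignature_monotone k ((hH q hqW).2 _ hreach)).trans_lt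
      (Pi.toColex_strictMono (Pi.lt_def.2 ⟨hle k hpk, k, ?_⟩))
    simpa [sig] using hrk' k hk hpk'

end Histories

section TraceLabels

/-- The information that the projected automaton guesses at a node `t` with parent `s`: the moves
`(a, s) → (b, t)` of a positional strategy, and for each parity the order type of the values of
the positions at `t` together with a bounded number of registers storing such values. -/
@[ext]
structure TraceLabel (A : Type) (N n : ℕ) where
  rel : A → A → Prop
  pos : Fin (N + 1) → A → Fin (n + 2)
  reg : Fin (N + 1) → Fin (n + 1) → Fin (n + 2)
  nxt : Fin (N + 1) → Fin (n + 1) → Fin (n + 1)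
  stable : Fin (N + 1) → Fin (n + 1) → Prop

namespace TraceLabel

variable {A : Type} {N n : ℕ}

instance [Finite A] : Finite (TraceLabel A N n) :=
  Finite.of_injective (fun ℓ => (ℓ.rel, ℓ.pos, ℓ.reg, ℓ.nxt, ℓ.stable)) fun ℓ ℓ' h => by
    simp only [Prod.mk.injEq] at h
    obtain ⟨h₁, h₂, h₃, h₄, h₅⟩ := h
    exact TraceLabel.ext h₁ h₂ h₃ h₄ h₅

/-- The label of the root, all of whose traces start at `a₀`. -/
def root (a₀ : A) : TraceLabel A N n where
  rel _ a := a = a₀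
  pos _ _ := Fin.last (n + 1)
  reg _ _ := 0
  nxt _ j := j
  stable _ _ := True

/-- Local consistency at parity `k` of the labels of a node and one of its children. -/
structure Consistent (Ω : A → ℕ) (k : Fin (N + 1)) (ℓ ℓ' : TraceLabel A N n) : Prop where
  exists_reg_eq : ∀ a b, ℓ'.rel a b → ∃ j, ℓ'.reg k j = ℓ'.pos k b
  nxt_le : ∀ j, ℓ'.nxt k j ≤ j
  pos_le : ∀ a b j, ℓ'.rel a b → Ω a ≤ k → ℓ.pos k a ≤ ℓ.reg k j →
    ℓ'.pos k b ≤ ℓ'.reg k (ℓ'.nxt k j)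
  pos_lt : ∀ a b j, ℓ'.rel a b → Ω a = k → ℓ.pos k a ≤ ℓ.reg k j → ℓ'.stable k j →
    ℓ'.pos k b < ℓ'.reg k j
  reg_lt : ∀ i j, ℓ.reg k i < ℓ.reg k j → ℓ'.stable k j →
    ℓ'.reg k (ℓ'.nxt k i) < ℓ'.reg k j

/-- The condition on the labels occurring infinitely often at parity `k`: a register that changes
infinitely often is renamed infinitely often. -/
def GoodAt (k : Fin (N + 1)) (I : Set (TraceLabel A N n)) : Prop :=
  ∀ j, (∃ ℓ ∈ I, ¬ ℓ.stable k j) → ∃ ℓ ∈ I, ℓ.nxt k j ≠ j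

/-- The Muller condition on the labels along a branch. -/
def Good (I : Set (TraceLabel A N n)) : Prop :=
  ∀ k : Fin (N + 1), Odd (k : ℕ) → GoodAt k I

theorem GoodAt.eventually_stable [Finite A] {k : Fin (N + 1)} {ℓ : ℕ → TraceLabel A N n}
    (h : GoodAt k (infOften ℓ)) :
    ∀ᶠ i in Filter.atTop, ∀ j, (∀ᶠ i in Filter.atTop, (ℓ i).nxt k j = j) → (ℓ i).stable k j := by
  filter_upwards [eventually_mem_infOften ℓ] with i hi j hj
  by_contra hst
  obtain ⟨ℓ', hℓ', hne⟩ := h j ⟨_, hi, hst⟩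
  obtain ⟨m, rfl, hm⟩ := (Filter.Frequently.and_eventually hℓ' hj).exists
  exact hne hm

theorem GoodAt.not_frequently_eq [Finite A] {Ω : A → ℕ} {k : Fin (N + 1)}
    {ℓ : ℕ → TraceLabel A N n} {a : ℕ → A} (hgood : GoodAt k (infOften ℓ))
    (hc : ∀ i, Consistent Ω k (ℓ i) (ℓ (i + 1)))
    (hrel : ∀ i, (ℓ (i + 1)).rel (a i) (a (i + 1)))
    (hle : ∀ᶠ i in Filter.atTop, Ω (a i) ≤ k) : ¬ ∃ᶠ i in Filter.atTop, Ω (a i) = k := by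
  intro hfreq
  obtain ⟨i₀, hi₀⟩ := Filter.eventually_atTop.1 (hgood.eventually_stable.and hle)
  replace hfreq := Filter.frequently_atTop.1 hfreq
  let J : Set (Fin (n + 1)) := {j | ∀ᶠ i in Filter.atTop, (ℓ i).nxt k j = j}
  let D : ℕ → Set (Fin (n + 1)) := fun i => {j ∈ J | (ℓ i).pos k (a i) < (ℓ i).reg k j}
  have hst : ∀ i ≥ i₀, ∀ j ∈ J, (ℓ i).stable k j := fun i hi => (hi₀ i hi).1
  have hN : ∀ i, ∃ j, (ℓ (i + 1)).reg k j = (ℓ (i + 1)).pos k (a (i + 1)) := fun i =>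
    (hc i).exists_reg_eq _ _ (hrel i)
  have hD : ∀ i ≥ i₀, D (i + 1) ⊆ D (i + 1 + 1) := by
    rintro i hi j ⟨hj, hlt⟩
    obtain ⟨j₁, hj₁⟩ := hN i
    exact ⟨hj, ((hc _).pos_le _ _ j₁ (hrel _) (hi₀ _ (by omega)).2 hj₁.ge).trans_lt
      ((hc _).reg_lt _ _ (hj₁ ▸ hlt) (hst _ (by omega) j hj))⟩
  have hgrow : ∀ i ≥ i₀, ∃ m ≥ i, ∃ j ∈ D (m + 1), j ∉ D (i + 1) := by
    intro i hi
    obtain ⟨j₀, hj₀⟩ := hN i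
    let c : ℕ → Fin (n + 1) := fun m => Nat.rec j₀ (fun m j => (ℓ (i + 1 + m + 1)).nxt k j) m
    have hcs : ∀ m, c (m + 1) = (ℓ (i + 1 + m + 1)).nxt k (c m) := fun m => rfl
    have hanti : Antitone c := antitone_nat_of_succ_le fun m => (hc _).nxt_le _
    obtain ⟨m₀, hm₀⟩ := WellFoundedLT.antitone_chain_condition hanti
    replace hm₀ : ∀ m ≥ m₀, c m = c m₀ := fun m hm => (hm₀ m hm).symm
    have hJ : c m₀ ∈ J := by
      refine Filter.eventually_atTop.2 ⟨i + 1 + m₀ + 1, fun m hm => ?_⟩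
      obtain ⟨d, rfl⟩ := Nat.exists_eq_add_of_le hm
      have := hcs (m₀ + d)
      rw [hm₀ (m₀ + d) (by omega), hm₀ (m₀ + d + 1) (by omega)] at this
      rw [show i + 1 + m₀ + 1 + d = i + 1 + (m₀ + d) + 1 by omega]
      exact this.symm
    have hpos : ∀ m, (ℓ (i + 1 + m)).pos k (a (i + 1 + m)) ≤ (ℓ (i + 1 + m)).reg k (c m) := by
      intro m
      induction m with
      | zero => exact hj₀.ge
      | succ m ih => exact (hc _).pos_le _ _ _ (hrel _) (hi₀ (i + 1 + m) (by omega)).2 ih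
    have hreg : ∀ j ∈ D (i + 1), ∀ m, (ℓ (i + 1 + m)).reg k (c m) < (ℓ (i + 1 + m)).reg k j := by
      intro j hj m
      induction m with
      | zero => exact hj₀.trans_lt hj.2
      | succ m ih => exact (hc _).reg_lt _ _ ih (hst (i + 1 + m + 1) (by omega) j hj.1)
    obtain ⟨m, hm, hmk⟩ := hfreq (i + 1 + m₀)
    obtain ⟨d, rfl⟩ := Nat.exists_eq_add_of_le hm
    have h := hpos (m₀ + d)
    rw [hm₀ _ (by omega), ← add_assoc] at h
    exact ⟨i + 1 + m₀ + d, by omega, c m₀,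
      ⟨hJ, (hc _).pos_lt _ _ _ (hrel _) hmk h (hst _ (by omega) _ hJ)⟩,
      fun hmem => (hreg _ hmem m₀).false⟩
  have hmono : Monotone fun i => D (i₀ + i + 1) :=
    monotone_nat_of_le_succ fun i => hD _ (by omega)
  obtain ⟨m, hm⟩ := WellFoundedGT.monotone_chain_condition ⟨_, hmono⟩
  obtain ⟨m', hm', j, hj, hj'⟩ := hgrow (i₀ + m) (by omega)
  obtain ⟨d, rfl⟩ := Nat.exists_eq_add_of_le hm'
  rw [add_assoc i₀] at hj
  have hDm : D (i₀ + m + 1) = D (i₀ + (m + d) + 1) := hm (m + d) (by omega)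
  exact hj' (hDm ▸ hj)

end TraceLabel

end TraceLabels
section OfRegisters

variable {A : Type} [Finite A] {N : ℕ} {O : Type*} [LinearOrder O]

/-- The number of elements of `D` with value at most `o`. -/
noncomputable def countLE (D : Set A) (v : A → O) (o : WithBot O) : Fin (Nat.card A + 2) :=
  ⟨{b ∈ D | (v b : WithBot O) ≤ o}.ncard, by
    have := Set.ncard_le_card {b ∈ D | (v b : WithBot O) ≤ o}
    omega⟩

theorem countLE_mono (D : Set A) (v : A → O) : Monotone (countLE D v) := fun _ _ h =>
  Fin.mk_le_mk.2 (Set.ncard_le_ncard fun _ hb => ⟨hb.1, hb.2.trans h⟩)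

theorem countLE_lt_countLE {D : Set A} {v : A → O} {o : WithBot O} {b : A} (hb : b ∈ D)
    (h : o < v b) : countLE D v o < countLE D v (v b) := by
  refine Fin.mk_lt_mk.2 (Set.ncard_lt_ncard ?_)
  have hsub : {b ∈ D | (v b : WithBot O) ≤ o} ⊆ {b' ∈ D | (v b' : WithBot O) ≤ v b} :=
    fun _ hb => ⟨hb.1, hb.2.trans h.le⟩
  exact (Set.ssubset_iff_of_subset hsub).2
    ⟨b, ⟨hb, le_rfl⟩, fun hb => h.not_ge hb.2⟩

theorem le_of_countLE_le {D : Set A} {v : A → O} {o : WithBot O} {b : A} (hb : b ∈ D)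
    (h : countLE D v (v b) ≤ countLE D v o) : v b ≤ o :=
  not_lt.1 fun hlt => (countLE_lt_countLE hb hlt).not_ge h

theorem IsRegisterStep.countLE_lt {n : ℕ} {D : Set A} {v : A → O}
    {r r' : Fin (n + 1) → WithBot O} {g : Fin (n + 1) → Fin (n + 1)}
    (h : IsRegisterStep r (v '' D) r' g) {o : WithBot O} {j : Fin (n + 1)} (hlt : o < r' j) :
    countLE D v o < countLE D v (r' j) := by
  rcases h.eq_bot_or j with hj | ⟨_, ⟨b, hb, rfl⟩, hj⟩
  · exact absurd hlt (hj ▸ not_lt_bot)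
  · rw [hj] at hlt ⊢
    exact countLE_lt_countLE hb hlt

namespace TraceLabel

/-- The label recording the values `v` of the elements of `D` and a register step
from `r` to `r'`. -/
noncomputable def ofRegisters (rel : A → A → Prop) (D : Set A) (v : Fin (N + 1) → A → O)
    (r r' : Fin (N + 1) → Fin (Nat.card A + 1) → WithBot O)
    (g : Fin (N + 1) → Fin (Nat.card A + 1) → Fin (Nat.card A + 1)) :
    TraceLabel A N (Nat.card A) where
  rel := rel
  pos k b := countLE D (v k) (v k b)
  reg k j := countLE D (v k) (r' k j)
  nxt := g
  stable k j := r' k j = r k j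

variable {Ω : A → ℕ} {k : Fin (N + 1)} {rel rel' : A → A → Prop} {D D' : Set A}
  {v v' : Fin (N + 1) → A → O} {r₀ r r' : Fin (N + 1) → Fin (Nat.card A + 1) → WithBot O}
  {g g' : Fin (N + 1) → Fin (Nat.card A + 1) → Fin (Nat.card A + 1)}

theorem consistent_root_ofRegisters {a₀ : A}
    (hstep : IsRegisterStep (r k) (v' k '' D') (r' k) (g' k)) (hrel : ∀ a b, rel' a b → b ∈ D') :
    (root a₀).Consistent Ω k (ofRegisters rel' D' v' r r' g') where
  exists_reg_eq a b h := by
    obtain ⟨j, hj⟩ := hstep.exists_eq _ (Set.mem_image_of_mem _ (hrel a b h))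
    exact ⟨j, congrArg (countLE D' (v' k)) hj⟩
  nxt_le := hstep.name_le
  pos_le a b j _ _ h := absurd h (Fin.last_pos (n := Nat.card A)).not_ge
  pos_lt a b j _ _ h := absurd h (Fin.last_pos (n := Nat.card A)).not_ge
  reg_lt i j h := absurd h (lt_irrefl _)

theorem consistent_ofRegisters
    (hstep : IsRegisterStep (r k) (v' k '' D') (r' k) (g' k))
    (hrel : ∀ a b, rel' a b → a ∈ D ∧ b ∈ D' ∧
      (Ω a ≤ k → v' k b ≤ v k a ∧ (Ω a = k → v' k b < v k a))) :
    (ofRegisters rel D v r₀ r g).Consistent Ω k (ofRegisters rel' D' v' r r' g') where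
  exists_reg_eq a b h := by
    obtain ⟨j, hj⟩ := hstep.exists_eq _ (Set.mem_image_of_mem _ (hrel a b h).2.1)
    exact ⟨j, congrArg (countLE D' (v' k)) hj⟩
  nxt_le := hstep.name_le
  pos_le a b j h hk hle := by
    obtain ⟨ha, hb, hv⟩ := hrel a b h
    exact countLE_mono _ _ (hstep.le_value _ (Set.mem_image_of_mem _ hb) _
      ((WithBot.coe_le_coe.2 (hv hk).1).trans (le_of_countLE_le ha hle)))
  pos_lt a b j h hk hle hs := by
    obtain ⟨ha, hb, hv⟩ := hrel a b h
    exact hstep.countLE_lt ((WithBot.coe_lt_coe.2 ((hv hk.le).2 hk)).trans_le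
      ((le_of_countLE_le ha hle).trans_eq hs.symm))
  reg_lt i j h hs :=
    hstep.countLE_lt ((hstep.value_le i).trans_lt
      (((countLE_mono D (v k)).reflect_lt (a := r k i) (b := r k j) h).trans_eq (Eq.symm hs)))

end TraceLabel

end OfRegisters

section Projection

variable {T : SetFunctor} {F : LiftingFamily T}

/-- The label read and the latest appearance memory of a state of the projected automaton. -/
abbrev ProjState (A : Type) (N n : ℕ) : Type :=
  TraceLabel A N n × (TraceLabel A N n → Set (TraceLabel A N n))

/-- The local constraint relating two successive states of the projected automaton. -/
def ProjState.Compat {A : Type} {N n : ℕ} (Ω : A → ℕ) (x y : ProjState A N n) : Prop :=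
  (∀ k : Fin (N + 1), Odd (k : ℕ) → x.1.Consistent Ω k y.1) ∧ y.2 = larUpdate x.2 x.1

namespace SOAutomaton

variable (aut : SOAutomaton T F) {N n : ℕ}

/-- The conditions of all states active in the label `ℓ` hold at the colour `c`, when the moves
are read off from the labels of the successors. -/
def ActiveSat (ℓ : TraceLabel aut.St N n) (c : Set ℕ) (X : Type) (α : T.obj X)
    (U : ProjState aut.St N n → Set X) : Prop :=
  ∀ a, (∃ a', ℓ.rel a' a) →
    (aut.Δ a c).sat0 X α fun b => {t | ∃ y : ProjState aut.St N n, y.1.rel a b ∧ t ∈ U y}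

/-- The transition condition of the projected automaton. -/
def ProjMove (q : ℕ) (x : ProjState aut.St N n) (c : Set ℕ) (X : Type) (α : T.obj X)
    (U : ProjState aut.St N n → Set X) : Prop :=
  ((∀ y y', y ≠ y' → Disjoint (U y) (U y')) ∧ ∀ y, ¬ x.Compat aut.Ω y → U y = ∅) ∧
    (aut.ActiveSat x.1 c X α U ∨ aut.ActiveSat x.1 (insert q c) X α U)

theorem oneStepDefinable_activeSat (ℓ : TraceLabel aut.St N n) (c : Set ℕ) :
    OneStepDefinable F (ProjState aut.St N n) (aut.ActiveSat ℓ c) := by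
  have := aut.fin
  exact .forall_finite fun a => .imp _ <| OneStepDefinable.subst_iUnion
    ⟨aut.Δ a c, aut.sentence a c, fun _ _ _ => Iff.rfl⟩ fun b (y : ProjState aut.St N n) => y.1.rel a b

theorem oneStepDefinable_projMove (q : ℕ) (x : ProjState aut.St N n) (c : Set ℕ) :
    OneStepDefinable F (ProjState aut.St N n) (aut.ProjMove q x c) := by
  have := aut.fin
  exact ((OneStepDefinable.forall_finite fun y => .forall_finite fun y' =>
    .imp _ (.disjoint y y')).and (.forall_finite fun y => .imp _ (.empty y))).and
    ((aut.oneStepDefinable_activeSat _ _).or (aut.oneStepDefinable_activeSat _ _))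

/-- The automaton obtained by projecting away the letter `q`. -/
noncomputable abbrev proj (N n q : ℕ) : SOAutomaton T F where
  P := aut.P \ {q}
  Pfin := aut.Pfin.subset Set.sdiff_subset
  St := ProjState aut.St N n
  fin := by
    have := aut.fin
    infer_instance
  aI := (TraceLabel.root aut.aI, fun _ => ∅)
  Ω x := larPriority TraceLabel.Good x.2 x.1
  Δ x c := (aut.oneStepDefinable_projMove q x c).choose
  sentence x c := (aut.oneStepDefinable_projMove q x c).choose_spec.1

variable {aut}

theorem legal_proj_iff {q : ℕ} {M : TreeModel T} {x : ProjState aut.St N n} {s : M.S}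
    {U : ProjState aut.St N n → Set M.S} :
    (aut.proj N n q).Legal M x s U ↔ (∀ y, U y ⊆ {t | M.R s t}) ∧
      aut.ProjMove q x ((aut.proj N n q).color M s) {t // M.R s t} (M.σloc s)
        fun y => {t | t.1 ∈ U y} :=
  and_congr Iff.rfl ((aut.oneStepDefinable_projMove q x _).choose_spec.2 _ _ _)

theorem color_updV {q : ℕ} (hq : q ∈ aut.P) (M : TreeModel T) (Z : Set M.S) (s : M.S) :
    aut.color { M with V := updV M.V q Z } s =
      if s ∈ Z then insert q ((aut.proj N n q).color M s) else (aut.proj N n q).color M s := by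
  ext p
  by_cases hp : p = q
  · subst hp
    split_ifs with hs <;> simp [color, updV, hs, hq]
  · split_ifs with hs <;> simp [color, updV, hp]

/-- A bounded sequence of parities is won unless some odd parity is the largest one occurring
infinitely often. -/
theorem winsParity_of_forall_odd {M : TreeModel T} {f : ℕ → aut.St × M.S}
    (hN : ∀ a, aut.Ω a ≤ N)
    (h : ∀ k : Fin (N + 1), Odd (k : ℕ) → (∀ᶠ i in Filter.atTop, aut.Ω (f i).1 ≤ k) →
      ¬ ∃ᶠ i in Filter.atTop, aut.Ω (f i).1 = k) :
    aut.WinsParity M f := by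
  have hex : ∃ k, ∀ᶠ i in Filter.atTop, aut.Ω (f i).1 ≤ k := ⟨N, .of_forall fun i => hN _⟩
  obtain ⟨k, hk, hmin⟩ : ∃ k, (∀ᶠ i in Filter.atTop, aut.Ω (f i).1 ≤ k) ∧
      ∀ j < k, ¬ ∀ᶠ i in Filter.atTop, aut.Ω (f i).1 ≤ j :=
    ⟨Nat.find hex, Nat.find_spec hex, fun _ => Nat.find_min hex⟩
  have hfreq : ∃ᶠ i in Filter.atTop, aut.Ω (f i).1 = k := by
    by_contra hne
    have hlt : ∀ᶠ i in Filter.atTop, aut.Ω (f i).1 < k := by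
      filter_upwards [hk, Filter.not_frequently.1 hne] with i h₁ h₂ using lt_of_le_of_ne h₁ h₂
    obtain ⟨i, hi⟩ := hlt.exists
    exact hmin (k - 1) (by omega) (hlt.mono fun i hi => by omega)
  have hkN : k < N + 1 := by
    obtain ⟨i, hi⟩ := hfreq.exists
    exact hi ▸ Nat.lt_succ_of_le (hN _)
  refine ⟨k, ?_, hfreq, fun m hm => ?_⟩
  · by_contra hodd
    exact h ⟨k, hkN⟩ (Nat.not_even_iff_odd.1 hodd) hk hfreq
  · obtain ⟨i, h₁, h₂⟩ := (hm.and_eventually hk).exists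
    omega

end SOAutomaton

theorem RPath.concat {S : Type} {R : S → S → Prop} {a s t : S} {l : List S} (h : RPath R a s l)
    (hst : R s t) : RPath R a t (l ++ [t]) := by
  induction h with
  | nil => exact .cons hst (.nil _)
  | cons hr _ ih => exact .cons hr (ih hst)

theorem RPath.end_unique {S : Type} {R : S → S → Prop} {a s t : S} {l : List S}
    (hs : RPath R a s l) (ht : RPath R a t l) : s = t := by
  induction hs with
  | nil => cases ht; rfl
  | cons _ _ ih =>
    cases ht with
    | cons _ ht => exact ih ht

theorem TreeModel.not_R_root (M : TreeModel T) (s : M.S) : ¬ M.R s M.root := fun h => by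
  obtain ⟨l, hl, -⟩ := M.tree s
  have := (M.tree M.root).unique (hl.concat h) (.nil _)
  simp at this

theorem TreeModel.parent_unique (M : TreeModel T) {s s' t : M.S} (h : M.R s t) (h' : M.R s' t) :
    s = s' := by
  obtain ⟨l, hl, -⟩ := M.tree s
  obtain ⟨l', hl', -⟩ := M.tree s'
  obtain rfl := List.append_cancel_right ((M.tree t).unique (hl.concat h) (hl'.concat h'))
  exact hl.end_unique hl'

theorem SOReach.eq_of_disjoint {aut : SOAutomaton T F} {M : TreeModel T}
    {st : List (aut.St × M.S) → aut.St → Set M.S}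
    (hR : ∀ p h b t, SOReach aut M st (p :: h) → t ∈ st (p :: h) b → M.R p.2 t)
    (hd : ∀ h b b' t, SOReach aut M st h → t ∈ st h b → t ∈ st h b' → b = b')
    {h h' : List (aut.St × M.S)} (hr : SOReach aut M st h) (hr' : SOReach aut M st h')
    (hh : h.head?.map Prod.snd = h'.head?.map Prod.snd) : h = h' := by
  induction hr generalizing h' with
  | base =>
    cases hr' with
    | base => rfl
    | step hr' hq =>
      simp only [List.head?_cons, Option.map_some, Option.some.injEq] at hh
      exact absurd (hh ▸ hR _ _ _ _ hr' hq) (M.not_R_root _)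
  | @step l p q hr hq ih =>
    cases hr' with
    | base =>
      simp only [List.head?_cons, Option.map_some, Option.some.injEq] at hh
      exact absurd (hh ▸ hR _ _ _ _ hr hq) (M.not_R_root _)
    | @step l' p' q' hr' hq' =>
      simp only [List.head?_cons, Option.map_some, Option.some.injEq] at hh
      have hp := M.parent_unique (hR _ _ _ _ hr hq) (hh ▸ hR _ _ _ _ hr' hq')
      have hl := ih hr' (by simp [hp])
      rw [← hl] at hq' ⊢
      rw [Prod.ext (hd _ _ _ _ hr hq (hh ▸ hq')) hh]


theorem SOAutomaton.accepts_updV_of_accepts_proj {aut : SOAutomaton T F} {N n q : ℕ}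
    (hq : q ∈ aut.P) (hN : ∀ a, aut.Ω a ≤ N) {M : TreeModel T}
    (h : (aut.proj N n q).Accepts M) :
    ∃ Z : Set M.S, aut.Accepts { M with V := updV M.V q Z } := by
  obtain ⟨st', hlegal, hwin⟩ := h
  have hlegal' := fun h x s hr => legal_proj_iff.1 (hlegal h x s hr)
  have huniq : ∀ {l l'}, SOReach _ M st' l → SOReach _ M st' l' →
      l.head?.map Prod.snd = l'.head?.map Prod.snd → l = l' := by
    refine fun hl hl' => SOReach.eq_of_disjoint
      (fun p h b t hr ht => (hlegal' h p.1 p.2 hr).1 b ht) (fun h b b' t hr hb hb' => ?_) hl hl'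
    obtain ⟨p, h, rfl⟩ := List.exists_cons_of_ne_nil hr.ne_nil
    by_contra hne
    obtain ⟨hR, ⟨hdisj, -⟩, -⟩ := hlegal' h p.1 p.2 hr
    exact Set.disjoint_left.1 (hdisj b b' hne)
      (show (⟨t, hR b hb⟩ : {t // M.R p.2 t}) ∈ _ from hb) hb'
  have huniq' : ∀ {x y : ProjState aut.St N n} {s : M.S} {l l'}, SOReach _ M st' ((x, s) :: l) →
      SOReach _ M st' ((y, s) :: l') → x = y ∧ l = l' := fun hr hr' => by
    simpa only [List.cons.injEq, Prod.mk.injEq, and_true] using huniq hr hr' rfl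
  let Z : Set M.S := {s | ∃ (x : ProjState aut.St N n) (l : _), SOReach _ M st' ((x, s) :: l) ∧
    aut.ActiveSat x.1 (insert q ((aut.proj N n q).color M s)) {t // M.R s t} (M.σloc s)
      fun y => {t | t.1 ∈ st' ((x, s) :: l) y}}
  let st : List (aut.St × M.S) → aut.St → Set M.S := fun l b =>
    {t | ∃ a s l₀, l = (a, s) :: l₀ ∧ ∃ (x : ProjState aut.St N n) (l' : _)
      (y : ProjState aut.St N n), SOReach _ M st' ((x, s) :: l') ∧
      t ∈ st' ((x, s) :: l') y ∧ y.1.rel a b}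
  have hst : ∀ {a s l b} {x : ProjState aut.St N n} {l'}, SOReach _ M st' ((x, s) :: l') →
      ∀ t, t ∈ st ((a, s) :: l) b ↔
        ∃ y : ProjState aut.St N n, y.1.rel a b ∧ t ∈ st' ((x, s) :: l') y := by
    intro a s l b x l' hr t
    constructor
    · rintro ⟨_, _, _, ⟨⟩, x', l'', y, hr', ht, hy⟩
      obtain ⟨rfl, rfl⟩ := huniq' hr hr'
      exact ⟨y, hy, ht⟩
    · rintro ⟨y, hy, ht⟩
      exact ⟨_, _, _, rfl, x, l', y, hr, ht, hy⟩
  let M' : TreeModel T := { M with V := updV M.V q Z }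
  have hinv : ∀ l, SOReach aut M' st l → ∀ a s l₀, l = (a, s) :: l₀ →
      ∃ (x : ProjState aut.St N n) (l' : _), SOReach _ M st' ((x, s) :: l') ∧
        ∃ a', x.1.rel a' a := by
    rintro l (_ | @⟨l₁, p, r, hr, hmem⟩) a s l₀ heq
    · cases heq
      exact ⟨_, [], .base, aut.aI, rfl⟩
    · obtain ⟨rfl, -⟩ := List.cons.inj heq
      obtain ⟨_, _, _, ⟨⟩, x, l', y, hr', ht, hy⟩ := hmem
      exact ⟨y, _, .step (aut := aut.proj N n q) (M := M) (q := (y, s)) hr' ht, _, hy⟩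
  refine ⟨Z, st, fun l a s hr => ?_, fun f hf₀ hf => ?_⟩
  · obtain ⟨x, l', hr', hact⟩ := hinv _ hr _ _ _ rfl
    obtain ⟨hR, -, hsat⟩ := hlegal' _ _ _ hr'
    refine ⟨fun b t ht => ?_, ?_⟩
    · obtain ⟨y, -, ht⟩ := (hst hr' t).1 ht
      exact hR y ht
    · have hset : (fun b => {t : {t // M.R s t} | t.1 ∈ st ((a, s) :: l) b}) = fun b =>
          {t | ∃ y : ProjState aut.St N n, y.1.rel a b ∧ t.1 ∈ st' ((x, s) :: l') y} :=
        funext fun b => Set.ext fun t => hst hr' t.1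
      change (aut.Δ a _).sat0 {t // M.R s t} (M.σloc s)
        fun b => {t : {t // M.R s t} | t.1 ∈ st ((a, s) :: l) b}
      rw [hset, color_updV (N := N) (n := n) hq]
      split_ifs with hs
      · obtain ⟨x', l'', hr'', hsat'⟩ := hs
        obtain ⟨rfl, rfl⟩ := huniq' hr' hr''
        exact hsat' a hact
      · exact hsat.resolve_right (fun h => hs ⟨x, l', hr', h⟩) a hact
  · have hreach := soReach_histPrefix (aut := aut) (M := M') hf₀ hf
    have hex : ∀ i, ∃ (x : ProjState aut.St N n) (l' : _),
        SOReach _ M st' ((x, (f i).2) :: l') := fun i => by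
      obtain ⟨l, hl⟩ := histPrefix_eq_cons f i
      obtain ⟨x, l', h, -⟩ := hinv _ (hreach i) _ _ _ hl
      exact ⟨x, l', h⟩
    choose x l hx using hex
    have hstep : ∀ i, (x (i + 1)).1.rel (f i).1 (f (i + 1)).1 ∧
        (f (i + 1)).2 ∈ st' ((x i, (f i).2) :: l i) (x (i + 1)) ∧
        l (i + 1) = (x i, (f i).2) :: l i := fun i => by
      obtain ⟨l₀, hl₀⟩ := histPrefix_eq_cons f i
      have hmem := hf i
      rw [hl₀] at hmem
      obtain ⟨y, hy, ht⟩ := (hst (hx i) _).1 hmem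
      obtain ⟨rfl, h⟩ := huniq' (hx (i + 1)) (.step
        (aut := aut.proj N n q) (M := M) (q := (y, (f (i + 1)).2)) (hx i) ht)
      exact ⟨hy, ht, h⟩
    have hx₀ : x 0 = (aut.proj N n q).aI ∧ l 0 = [] := by
      have := hx 0
      rw [hf₀] at this
      exact huniq' this .base
    let f' : ℕ → ProjState aut.St N n × M.S := fun i => (x i, (f i).2)
    have hpre : ∀ i, histPrefix f' i = (x i, (f i).2) :: l i := fun i => by
      induction i with
      | zero => rw [hx₀.2]; rfl
      | succ i ih => rw [histPrefix_succ, ih, (hstep i).2.2]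
    have hcompat : ∀ i, (x i).Compat aut.Ω (x (i + 1)) := fun i => by
      by_contra hc
      obtain ⟨hR, ⟨-, hempty⟩, -⟩ := hlegal' _ _ _ (hx i)
      exact (Set.eq_empty_iff_forall_notMem.1 (hempty _ hc)) ⟨_, hR _ (hstep i).2.1⟩
        (hstep i).2.1
    have := aut.fin
    have hgood := (larPriority_parity_iff TraceLabel.Good (x := fun i => (x i).1) (m := fun i => (x i).2)
      (congrArg Prod.snd hx₀.1) fun i => (hcompat i).2).1
      (hwin f' (by simp only [f', hx₀.1, hf₀]) fun i => by
        rw [hpre]; exact (hstep i).2.1)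
    exact winsParity_of_forall_odd hN fun k hk => (hgood k hk).not_frequently_eq
      (fun i => (hcompat i).1 k hk) fun i => (hstep i).1

theorem SOAutomaton.accepts_proj_of_accepts_updV {aut : SOAutomaton T F} {N q : ℕ}
    (hq : q ∈ aut.P) {M : TreeModel T} {Z : Set M.S}
    (h : aut.Accepts { M with V := updV M.V q Z }) :
    (aut.proj N (Nat.card aut.St) q).Accepts M := by
  have := aut.fin
  obtain ⟨O, _, _, W, U, v, hroot, hlegal, hW⟩ := h.exists_positional N
  let D : M.S → Set aut.St := fun s => {a | (a, s) ∈ W}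
  let w : M.S → Fin (N + 1) → aut.St → O := fun s k a => v k (a, s)
  have hreg : ∀ k : Fin (N + 1), ∃ (r : List M.S → Fin (Nat.card aut.St + 1) → WithBot O)
      (g : List M.S → Fin (Nat.card aut.St + 1) → Fin (Nat.card aut.St + 1)),
      ∀ s l, IsRegisterStep (r l) (w s k '' D s) (r (s :: l)) (g (s :: l)) := fun k => by
    obtain ⟨r, g, h⟩ := exists_registers (n := Nat.card aut.St)
      (fun s => (Set.toFinite (w s k '' D s)).toFinset) fun s => by
        rw [← Set.ncard_eq_toFinset_card _ (Set.toFinite _)]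
        exact (Set.ncard_image_le (f := w s k) (Set.toFinite (D s))).trans (Set.ncard_le_card (D s))
    exact ⟨r, g, fun s l => by simpa using h s l⟩
  choose r g hstep using hreg
  let rel : M.S → M.S → aut.St → aut.St → Prop := fun s t a b => (a, s) ∈ W ∧ t ∈ U (a, s) b
  let lab : List M.S → TraceLabel aut.St N (Nat.card aut.St)
    | t :: s :: l => .ofRegisters (rel s t) (D t) (w t) (fun k => r k (s :: l))
        (fun k => r k (t :: s :: l)) fun k => g k (t :: s :: l)
    | _ => .root aut.aI
  have hcons : ∀ s t l (k : Fin (N + 1)), Odd (k : ℕ) →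
      (lab (s :: l)).Consistent aut.Ω k (lab (t :: s :: l)) := by
    intro s t l k hk
    have hrel : ∀ s a b, rel s t a b → a ∈ D s ∧ b ∈ D t ∧
        (aut.Ω a ≤ k → w t k b ≤ w s k a ∧ (aut.Ω a = k → w t k b < w s k a)) := fun s a b h => by
      obtain ⟨h₁, h₂⟩ := hW (a, s) h.1 (b, t) h.2
      exact ⟨h.1, h₁, h₂ k hk⟩
    cases l with
    | nil => exact TraceLabel.consistent_root_ofRegisters (hstep k t [s]) fun a b h =>
        (hrel s a b h).2.1
    | cons s' l => exact TraceLabel.consistent_ofRegisters (hstep k t (s :: s' :: l)) (hrel s)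
  let st : List (ProjState aut.St N (Nat.card aut.St) × M.S) →
      ProjState aut.St N (Nat.card aut.St) → Set M.S := fun h y =>
    {t | ∃ x s l, h = (x, s) :: l ∧ M.R s t ∧ y.1 = lab (t :: s :: l.map Prod.snd) ∧
      y.2 = larUpdate x.2 x.1}
  have hst : ∀ x s l y t, t ∈ st ((x, s) :: l) y ↔
      M.R s t ∧ y.1 = lab (t :: s :: l.map Prod.snd) ∧ y.2 = larUpdate x.2 x.1 := by
    intro x s l y t
    constructor
    · rintro ⟨_, _, _, ⟨⟩, h⟩
      exact h
    · exact fun h => ⟨_, _, _, rfl, h⟩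
  have hinv : ∀ h, SOReach (aut.proj N (Nat.card aut.St) q) M st h → ∀ x s l, h = (x, s) :: l →
      x.1 = lab (s :: l.map Prod.snd) ∧ ∀ a, (∃ a', x.1.rel a' a) → (a, s) ∈ W := by
    rintro h (_ | @⟨l₁, p, p', hr, hmem⟩) x s l heq
    · cases heq
      refine ⟨rfl, ?_⟩
      rintro a ⟨a', rfl⟩
      exact hroot
    · obtain ⟨rfl, rfl⟩ := List.cons.inj heq
      obtain ⟨-, h₁, -⟩ := (hst _ _ _ _ _).1 hmem
      refine ⟨h₁, ?_⟩
      rintro a ⟨a', ha⟩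
      rw [h₁] at ha
      exact (hW _ ha.1 (a, s) ha.2).1
  refine ⟨st, fun l x s hr => legal_proj_iff.2 ⟨fun y t ht => ((hst _ _ _ _ _).1 ht).1,
    ⟨fun y y' hne => ?_, fun y hy => ?_⟩, ?_⟩, fun f hf₀ hf => ?_⟩
  · refine Set.disjoint_left.2 fun t ht ht' => hne ?_
    obtain ⟨-, h₁, h₂⟩ := (hst _ _ _ _ _).1 ht
    obtain ⟨-, h₁', h₂'⟩ := (hst _ _ _ _ _).1 ht'
    exact Prod.ext (h₁.trans h₁'.symm) (h₂.trans h₂'.symm)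
  · refine Set.eq_empty_iff_forall_notMem.2 fun t ht => hy ?_
    obtain ⟨-, h₁, h₂⟩ := (hst _ _ _ _ _).1 ht
    refine ⟨fun k hk => ?_, h₂⟩
    rw [h₁, (hinv _ hr _ _ _ rfl).1]
    exact hcons _ _ _ k hk
  · have hsat : ∀ c, c = aut.color { M with V := updV M.V q Z } s →
        aut.ActiveSat x.1 c {t // M.R s t} (M.σloc s) fun y => {t | t.1 ∈ st ((x, s) :: l) y} := by
      rintro _ rfl a ha
      have haW := (hinv _ hr _ _ _ rfl).2 a ha
      obtain ⟨-, h⟩ := hlegal _ haW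
      convert h using 1
      funext b
      ext t
      constructor
      · rintro ⟨y, hy, ht⟩
        obtain ⟨-, h₁, -⟩ := (hst _ _ _ _ _).1 ht
        rw [h₁] at hy
        exact hy.2
      · exact fun ht => ⟨(lab (t.1 :: s :: l.map Prod.snd), larUpdate x.2 x.1), ⟨haW, ht⟩,
          (hst _ _ _ _ _).2 ⟨t.2, rfl, rfl⟩⟩
    have hcol := color_updV (N := N) (n := Nat.card aut.St) hq M Z s
    by_cases hs : s ∈ Z
    · exact .inr (hsat _ (by rw [hcol, if_pos hs]))
    · exact .inl (hsat _ (by rw [hcol, if_neg hs]))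
  · have hreach := soReach_histPrefix (aut := aut.proj N (Nat.card aut.St) q) (M := M) hf₀ hf
    let ss : ℕ → List M.S := fun i => (histPrefix f i).map Prod.snd
    have hss : ∀ i, ss (i + 1) = (f (i + 1)).2 :: ss i := fun i => by
      simp only [ss, histPrefix_succ, List.map_cons]
    have hne : ∀ i, ∃ s l, ss i = s :: l := fun i => by
      obtain ⟨l, hl⟩ := histPrefix_eq_cons f i
      exact ⟨(f i).2, l.map Prod.snd, by simp only [ss, hl, List.map_cons]⟩
    have hlab : ∀ i, (f i).1.1 = lab (ss i) := fun i => by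
      obtain ⟨l, hl⟩ := histPrefix_eq_cons f i
      rw [(hinv _ (hreach i) _ _ _ hl).1]
      simp only [ss, hl, List.map_cons]
    refine (larPriority_parity_iff TraceLabel.Good (x := fun i => (f i).1.1)
      (m := fun i => (f i).1.2) ?_ fun i => ?_).2 fun k hk j hs => ?_
    · rw [hf₀]
    · obtain ⟨l, hl⟩ := histPrefix_eq_cons f i
      have hmem := hf i
      rw [hl] at hmem
      exact ((hst _ _ _ _ _).1 hmem).2.2
    · by_contra! hnxt
      obtain ⟨ℓ, hℓ, hns⟩ := hs
      have hℓs : ∀ i, (f (i + 1)).1.1.nxt k = g k (ss (i + 1)) ∧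
          ((f (i + 1)).1.1.stable k j ↔ r k (ss (i + 1)) j = r k (ss i) j) := fun i => by
        obtain ⟨s, l, hl⟩ := hne i
        rw [hlab, hss, hl]
        exact ⟨rfl, Iff.rfl⟩
      have hg : ∀ᶠ i in Filter.atTop, g k (ss (i + 1)) j = j := by
        filter_upwards [(Filter.tendsto_add_atTop_nat 1).eventually
          (eventually_mem_infOften fun i => (f i).1.1)] with i hi
        rw [← (hℓs i).1]
        exact hnxt _ hi
      have hev := IsRegisterStep.eventually_eq (r := fun i => r k (ss i))
        (g := fun i => g k (ss (i + 1))) (fun i => by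
          simp only [hss]
          exact hstep k (f (i + 1)).2 (ss i)) hg
      have hstable : ∀ᶠ i in Filter.atTop, (f i).1.1.stable k j := by
        obtain ⟨i₀, hi₀⟩ := Filter.eventually_atTop.1 hev
        refine Filter.eventually_atTop.2 ⟨i₀ + 1, fun i hi => ?_⟩
        obtain ⟨i, rfl⟩ : ∃ i', i = i' + 1 := ⟨i - 1, by omega⟩
        exact (hℓs i).2.2 (hi₀ i (by omega))
      obtain ⟨i, hi, hi'⟩ := (Filter.Frequently.and_eventually hℓ hstable).exists
      exact hns (hi ▸ hi')

end Projection

/-- Over `T`-tree models, the class of second-order `Λ`-automata is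
closed under existential projection. -/
theorem so_automata_closed_under_projection (T : SetFunctor) (F : LiftingFamily T)
    (aut : SOAutomaton T F) (q : ℕ) (hq : q ∈ aut.P) :
    ∃ aut' : SOAutomaton T F, aut'.P = aut.P \ {q} ∧
      ∀ M : TreeModel T, aut'.Accepts M ↔
        ∃ Z : Set M.S, aut.Accepts { M with V := updV M.V q Z } := by
  obtain ⟨N, hN⟩ : ∃ N, ∀ a, aut.Ω a ≤ N := by
    have := aut.fin
    obtain ⟨N, hN⟩ := (Set.finite_range aut.Ω).bddAbove
    exact ⟨N, fun a => hN ⟨a, rfl⟩⟩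
  exact ⟨aut.proj N (Nat.card aut.St) q, rfl, fun M =>
    ⟨SOAutomaton.accepts_updV_of_accepts_proj hq hN,
      fun ⟨_, hZ⟩ => SOAutomaton.accepts_proj_of_accepts_updV hq hZ⟩⟩
end
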